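/- arXiv:2408.07631 — 4 statements merged into one kernel-verified Lean document; each statement's English description precedes it below -/
import Mathlib

section
/- Let q > 1 be a real number, let a > 0 and ε > 0 be real numbers, let b ≥ 1 be an integer, let X be a countable set and let H : X → ℝ be a function taking values in {q^m : m ∈ ℕ}. Suppose the series ζ_H(s) = ∑_{x∈X} H(x)^{−s} converges absolutely for Re(s) > a, and that ζ_H extends to a meromorphic function on the half-plane Re(s) ≥ a − ε satisfying: (1) ζ_H has a pole of order b at s = a; (2) there exist real numbers 0 = θ₀ < θ₁ < … < θ_n < 1 such that ζ_H is holomorphic at every point s with Re(s) > a − ε which is not of the form a + 2πi(θ_k + m)/log q for some k ∈ {0,…,n} and m ∈ ℤ; (3) for every k ∈ {1,…,n}, at the point s_k := a + 2πiθ_k/log q the function ζ_H is either holomorphic or has a pole of order at most b. Then for every M ∈ ℕ the cardinality Ñ(q^M) := #{x ∈ X : H(x) = q^M} is finite, and for each k ∈ {0,…,n} there exists a polynomial Q_k of degree at most b−1 whose coefficient of M^{b−1} equals r_k := lim_{s→s_k} (s−s_k)^b ζ_H(s), such that for every δ > a − ε one has Ñ(q^M) = ((log q)^b/(b−1)!)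 · q^{aM} · ∑_{k=0}^{n} e^{2πiθ_k M} Q_k(M) + O(q^{δM}) as M → ∞ through the integers. -/
open Filter

/-- `Z` has a pole of order exactly `b` at `s₀`: near `s₀` (away from `s₀`) one has
`Z s = g s / (s - s₀) ^ b` with `g` analytic at `s₀` and `g s₀ ≠ 0`. -/
def HasPoleOfOrder (Z : ℂ → ℂ) (b : ℕ) (s₀ : ℂ) : Prop :=
  ∃ g : ℂ → ℂ, AnalyticAt ℂ g s₀ ∧ g s₀ ≠ 0 ∧
    ∀ᶠ s in nhdsWithin s₀ {s₀}ᶜ, Z s = g s / (s - s₀) ^ b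

/-- `Z` is holomorphic at `s₀`, or has a pole of order at most `b` there: near `s₀`
(away from `s₀`) one has `Z s = g s / (s - s₀) ^ b` with `g` analytic at `s₀`. -/
def HolomorphicOrPoleOfOrderLe (Z : ℂ → ℂ) (b : ℕ) (s₀ : ℂ) : Prop :=
  ∃ g : ℂ → ℂ, AnalyticAt ℂ g s₀ ∧
    ∀ᶠ s in nhdsWithin s₀ {s₀}ᶜ, Z s = g s / (s - s₀) ^ b

/-- Cauchy estimate: the coefficients of a power series whose sum extends holomorphically to a
punctured disc of radius `R` are `O(ρ⁻ᴹ)` for every `ρ < R`. -/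
theorem exists_norm_coeff_mul_pow_le {d : ℕ → ℂ} {h : ℂ → ℂ} {r R ρ : ℝ} (hr : 0 < r)
    (hsum : ∀ T : ℂ, T ≠ 0 → ‖T‖ < r → HasSum (fun M => d M * T ^ M) (h T))
    (hdiff : ∀ T : ℂ, T ≠ 0 → ‖T‖ < R → DifferentiableAt ℂ h T)
    (hρ : 0 < ρ) (hρR : ρ < R) :
    ∃ C, ∀ M, ‖d M‖ * ρ ^ M ≤ C := by
  obtain ⟨ρ', h1, h2⟩ := exists_between hρR
  have hρ' : 0 < ρ' := hρ.trans h1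
  set f := Function.update h 0 (d 0) with hf
  have hser : HasFPowerSeriesAt f (FormalMultilinearSeries.ofScalars ℂ d) 0 := by
    rw [hasFPowerSeriesAt_iff]
    filter_upwards [Metric.ball_mem_nhds (0 : ℂ) hr] with T hT
    rw [mem_ball_zero_iff] at hT
    simp only [FormalMultilinearSeries.coeff_ofScalars, zero_add, smul_eq_mul]
    by_cases h0 : T = 0
    · subst h0
      have := hasSum_single (f := fun n => (0 : ℂ) ^ n * d n) 0 (fun n hn => by simp [hn])
      simpa [hf] using this
    · rw [hf, Function.update_of_ne h0]
      simpa [mul_comm] using hsum T h0 hT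
  have hfd : DifferentiableOn ℂ f (Metric.closedBall 0 (⟨ρ', hρ'.le⟩ : NNReal)) := by
    intro T hT
    rw [mem_closedBall_zero_iff] at hT
    apply DifferentiableAt.differentiableWithinAt
    by_cases h0 : T = 0
    · subst h0
      exact hser.analyticAt.differentiableAt
    · refine (hdiff T h0 (lt_of_le_of_lt hT h2)).congr_of_eventuallyEq ?_
      filter_upwards [isOpen_ne.mem_nhds h0] with S hS
      exact Function.update_of_ne hS _ _
  have hball := hfd.hasFPowerSeriesOnBall (NNReal.coe_pos.1 hρ')
  have heq := hser.eq_formalMultilinearSeries hball.hasFPowerSeriesAt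
  have hrad : ENNReal.ofNNReal ⟨ρ, hρ.le⟩ <
      (FormalMultilinearSeries.ofScalars ℂ d).radius := by
    rw [heq]
    refine lt_of_lt_of_le ?_ hball.r_le
    exact ENNReal.coe_lt_coe.2 h1
  obtain ⟨C, -, hC⟩ := FormalMultilinearSeries.norm_mul_pow_le_of_lt_radius _ hrad
  refine ⟨C, fun M => ?_⟩
  have hM := hC M
  rwa [FormalMultilinearSeries.ofScalars_norm] at hM

/-- A holomorphic function on a right half-plane with period `2πi/L` is a holomorphic function
of `exp (-L s)`. -/
theorem exists_differentiableAt_comp_exp {G : ℂ → ℂ} {L σ : ℝ} (hL : 0 < L)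
    (hG : ∀ s : ℂ, σ < s.re → DifferentiableAt ℂ G s)
    (hper : ∀ s : ℂ, σ < s.re → G (s + 2 * (Real.pi : ℂ) * Complex.I / (L : ℂ)) = G s) :
    ∃ h : ℂ → ℂ, (∀ T : ℂ, T ≠ 0 → ‖T‖ < Real.exp (-L * σ) → DifferentiableAt ℂ h T) ∧
      ∀ s : ℂ, σ < s.re → h (Complex.exp (-L * s)) = G s := by
  have hLc : (L : ℂ) ≠ 0 := by exact_mod_cast hL.ne'
  set c : ℂ := -(2 * (Real.pi : ℂ) * Complex.I / (L : ℂ)) with hc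
  have hcre : c.re = 0 := by
    have : c = ((-(2 * Real.pi / L) : ℝ) : ℂ) * Complex.I := by
      rw [hc]; push_cast; ring
    rw [this]; simp
  have hcim : c.im = -(2 * Real.pi / L) := by
    have : c = ((-(2 * Real.pi / L) : ℝ) : ℂ) * Complex.I := by
      rw [hc]; push_cast; ring
    rw [this]; simp
  have hc0 : c ≠ 0 := by
    intro h0
    have := Real.pi_pos
    have h1 : -(2 * Real.pi / L) = 0 := by rw [← hcim, h0]; rfl
    have : 0 < 2 * Real.pi / L := by positivity
    linarith
  classical
  set G' : ℂ → ℂ := fun s => if σ < s.re then G s else 0 with hG'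
  have hperiod : Function.Periodic (fun z => G' (c * z)) ((1 : ℝ) : ℂ) := by
    intro z
    have e : c * (z + (1 : ℝ)) = c * z + c := by push_cast; ring
    simp only [hG', e, Complex.add_re, hcre, add_zero]
    split_ifs with hz
    · have := hper (c * z + c) (by simpa [hcre] using hz)
      rw [← this]; congr 1; rw [hc]; ring
    · rfl
  have hexp : ∀ z : ℂ, Function.Periodic.qParam 1 z = Complex.exp (-L * (c * z)) := by
    intro z
    rw [Function.Periodic.qParam, hc]
    congr 1
    push_cast
    field_simp
  refine ⟨Function.Periodic.cuspFunction 1 (fun z => G' (c * z)), ?_, ?_⟩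
  · intro T hT hTn
    obtain ⟨w, rfl⟩ : ∃ w, Complex.exp w = T := ⟨_, Complex.exp_log hT⟩
    set s : ℂ := -w / L with hs
    have hw : w = -L * s := by rw [hs]; field_simp
    rw [hw] at hTn ⊢
    have hsre : σ < s.re := by
      rw [Complex.norm_exp, Real.exp_lt_exp] at hTn
      simp at hTn
      nlinarith
    have hq := hexp (s / c)
    rw [mul_div_cancel₀ _ hc0] at hq
    rw [← hq]
    apply Function.Periodic.differentiableAt_cuspFunction one_ne_zero hperiod
    have h1 : DifferentiableAt ℂ G' (c * (s / c)) := by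
      rw [mul_div_cancel₀ _ hc0]
      refine (hG s hsre).congr_of_eventuallyEq ?_
      filter_upwards [(isOpen_lt continuous_const Complex.continuous_re).mem_nhds hsre] with t ht
      exact if_pos ht
    exact DifferentiableAt.comp (s / c) (g := G') (f := fun z => c * z) h1
      (differentiableAt_id.const_mul c)
  · intro s hs
    have hq := hexp (s / c)
    rw [mul_div_cancel₀ _ hc0] at hq
    rw [← hq, Function.Periodic.eq_cuspFunction one_ne_zero hperiod, mul_div_cancel₀ _ hc0]
    exact if_pos hs

/-- A function which near each point of `U` agrees, off the point, with an analytic function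
can be corrected to be analytic on `U`. -/
theorem exists_analyticAt_eventuallyEq_nhdsNE {F : ℂ → ℂ} {U : Set ℂ} (hU : IsOpen U)
    (hF : ∀ s ∈ U, ∃ g : ℂ → ℂ, AnalyticAt ℂ g s ∧ F =ᶠ[nhdsWithin s {s}ᶜ] g) :
    ∃ G : ℂ → ℂ, ∀ s ∈ U, AnalyticAt ℂ G s ∧ F =ᶠ[nhdsWithin s {s}ᶜ] G := by
  choose! g hg hFg using hF
  have key : ∀ s ∈ U, (fun t => g t t) =ᶠ[nhds s] g s := by
    intro s hs
    have h1 : ∀ᶠ t in nhdsWithin s {s}ᶜ, F =ᶠ[nhdsWithin t {t}ᶜ] g s := by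
      have := eventually_eventually_nhdsWithin.2 (hFg s hs)
      filter_upwards [this, self_mem_nhdsWithin] with t ht hts
      have ho : nhdsWithin t {s}ᶜ = nhds t := isOpen_compl_singleton.nhdsWithin_eq hts
      rw [ho] at ht
      exact ht.filter_mono nhdsWithin_le_nhds
    have h2 := eventually_nhdsWithin_iff.1 h1
    filter_upwards [h2, (hg s hs).eventually_analyticAt, hU.mem_nhds hs] with t ht hgt htU
    by_cases hts : t = s
    · subst hts; rfl
    · have h3 := (hFg t htU).symm.trans (ht hts)
      exact (((hg t htU).continuousAt.eventuallyEq_nhds_iff_eventuallyEq_nhdsNE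
        hgt.continuousAt).1 h3).eq_of_nhds
  refine ⟨fun t => g t t, fun s hs => ⟨(hg s hs).congr (key s hs).symm, ?_⟩⟩
  exact (hFg s hs).trans ((key s hs).symm.filter_mono nhdsWithin_le_nhds)

theorem AnalyticAt.dslope_self {f : ℂ → ℂ} {s : ℂ} (hf : AnalyticAt ℂ f s) :
    AnalyticAt ℂ (dslope f s) s :=
  let ⟨_, hp⟩ := hf
  hp.has_fpower_series_dslope_fslope.analyticAt

/-- Finite Taylor expansion in powers of a local coordinate `u` with a simple zero at `s`. -/
theorem AnalyticAt.exists_eq_sum_mul_pow_add {u f : ℂ → ℂ} {s : ℂ} (hu : AnalyticAt ℂ u s)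
    (hu0 : u s = 0) (hu' : deriv u s ≠ 0) (hf : AnalyticAt ℂ f s) (b : ℕ) :
    ∃ (c : ℕ → ℂ) (g : ℂ → ℂ), c 0 = f s ∧ AnalyticAt ℂ g s ∧
      ∀ᶠ t in nhds s, f t = ∑ j ∈ Finset.range b, c j * u t ^ j + u t ^ b * g t := by
  induction b generalizing f with
  | zero => exact ⟨fun _ => f s, f, rfl, hf, by simp⟩
  | succ b ih =>
    have hv0 : dslope u s s ≠ 0 := by rwa [dslope_same]
    obtain ⟨c, g, -, hg, hc⟩ := ih (hf.dslope_self.div hu.dslope_self hv0)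
    refine ⟨fun j => Nat.casesOn j (f s) c, g, rfl, hg, ?_⟩
    filter_upwards [hc, hu.dslope_self.continuousAt.eventually_ne hv0] with t ht hvt
    have e1 := sub_smul_dslope f s t
    have e2 := sub_smul_dslope u s t
    rw [hu0, sub_zero, smul_eq_mul] at e2
    rw [smul_eq_mul] at e1
    have e3 : f t = f s + u t * (dslope f s t / dslope u s t) := by
      rw [← e2]; field_simp; linear_combination -e1
    rw [Pi.div_apply] at ht
    rw [e3, ht, Finset.sum_range_succ', mul_add, Finset.mul_sum]
    simp only [pow_zero, mul_one, pow_succ]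
    have : ∀ j, u t * (c j * u t ^ j) = c j * (u t ^ j * u t) := fun j => by ring
    simp only [this]
    change _ = _ + f s + _
    ring

/-- The binomial coefficient `(M + k).choose k` is a polynomial in `M` of degree `k` with leading
coefficient `1 / k!`. -/
theorem exists_polynomial_eval_eq_choose (k : ℕ) :
    ∃ p : Polynomial ℂ, p.natDegree = k ∧ p.coeff k = 1 / (k.factorial : ℂ) ∧
      ∀ M : ℕ, p.eval (M : ℂ) = ((M + k).choose k : ℂ) := by
  have hk : (k.factorial : ℂ) ≠ 0 := by exact_mod_cast k.factorial_ne_zero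
  have hd : ((ascPochhammer ℂ k).comp (Polynomial.X + Polynomial.C 1)).natDegree = k := by
    rw [Polynomial.natDegree_comp, Polynomial.natDegree_X_add_C, ascPochhammer_natDegree, mul_one]
  have hm : ((ascPochhammer ℂ k).comp (Polynomial.X + Polynomial.C 1)).Monic :=
    (monic_ascPochhammer ℂ k).comp_X_add_C 1
  refine ⟨Polynomial.C (1 / (k.factorial : ℂ)) *
    (ascPochhammer ℂ k).comp (Polynomial.X + Polynomial.C 1), ?_, ?_, fun M => ?_⟩
  · rw [Polynomial.natDegree_C_mul (one_div_ne_zero hk), hd]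
  · have := hm.coeff_natDegree
    rw [hd] at this
    rw [Polynomial.coeff_C_mul, this, mul_one]
  · have h1 : (M : ℂ) + 1 = ((M + 1 : ℕ) : ℂ) := by push_cast; rfl
    simp only [Polynomial.eval_mul, Polynomial.eval_C, Polynomial.eval_comp, Polynomial.eval_add,
      Polynomial.eval_X]
    rw [h1, ← ascPochhammer_eval_cast, ascPochhammer_nat_eq_ascFactorial,
      Nat.ascFactorial_eq_factorial_mul_choose]
    push_cast
    field_simp

/-- Removal of the principal part at a pole, in powers of `1 - exp (-L (s - s₀))`. -/
theorem exists_principal_part {Z g : ℂ → ℂ} {L : ℝ} (hL : 0 < L) {b : ℕ} {s₀ : ℂ}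
    (hg : AnalyticAt ℂ g s₀) (hZ : ∀ᶠ s in nhdsWithin s₀ {s₀}ᶜ, Z s = g s / (s - s₀) ^ b) :
    ∃ (c : ℕ → ℂ) (f : ℂ → ℂ), c 0 = (L : ℂ) ^ b * g s₀ ∧ AnalyticAt ℂ f s₀ ∧
      ∀ᶠ s in nhdsWithin s₀ {s₀}ᶜ,
        Z s - ∑ j ∈ Finset.range b, c j / (1 - Complex.exp (-L * (s - s₀))) ^ (b - j) = f s := by
  set u : ℂ → ℂ := fun s => 1 - Complex.exp (-L * (s - s₀)) with hu
  have hLc : (L : ℂ) ≠ 0 := by exact_mod_cast hL.ne'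
  have hud : HasDerivAt u L s₀ := by
    have h1 : HasDerivAt (fun s : ℂ => -(L : ℂ) * (s - s₀)) (-(L : ℂ) * 1) s₀ :=
      ((hasDerivAt_id s₀).sub_const s₀).const_mul _
    have h2 := (h1.cexp).const_sub 1
    refine h2.congr_deriv ?_
    simp
  have hua : AnalyticAt ℂ u s₀ := by fun_prop
  have hu0 : u s₀ = 0 := by simp [hu]
  have hu' : deriv u s₀ ≠ 0 := by rwa [hud.deriv]
  have hv0 : dslope u s₀ s₀ ≠ 0 := by rwa [dslope_same]
  obtain ⟨c, f, hc0, hf, hc⟩ := hua.exists_eq_sum_mul_pow_add hu0 hu'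
    ((hua.dslope_self.pow b).mul hg) b
  refine ⟨c, f, ?_, hf, ?_⟩
  · rw [hc0]; simp [dslope_same, hud.deriv]
  · filter_upwards [hZ, hc.filter_mono nhdsWithin_le_nhds, self_mem_nhdsWithin,
      (hua.dslope_self.continuousAt.eventually_ne hv0).filter_mono nhdsWithin_le_nhds]
      with t hZt hct hts hvt
    have hts' : t - s₀ ≠ 0 := sub_ne_zero.2 hts
    have e2 := sub_smul_dslope u s₀ t
    rw [hu0, sub_zero, smul_eq_mul] at e2
    have hut : u t ≠ 0 := by rw [← e2]; exact mul_ne_zero hts' hvt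
    change Z t - ∑ j ∈ Finset.range b, c j / u t ^ (b - j) = f t
    have e3 : Z t = (dslope u s₀ t ^ b * g t) / u t ^ b := by
      rw [hZt, ← e2, mul_pow]; field_simp
    simp only [Pi.mul_apply, Pi.pow_apply] at hct
    have e4 : ∑ j ∈ Finset.range b, c j / u t ^ (b - j)
        = (∑ j ∈ Finset.range b, c j * u t ^ j) / u t ^ b := by
      rw [Finset.sum_div]
      refine Finset.sum_congr rfl fun j hj => ?_
      rw [div_eq_div_iff (pow_ne_zero _ hut) (pow_ne_zero _ hut), mul_assoc, ← pow_add,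
        Nat.add_sub_cancel' (Finset.mem_range.1 hj).le]
    rw [e3, e4, hct, ← sub_div, add_sub_cancel_left, mul_div_cancel_left₀ _ (pow_ne_zero _ hut)]

/-- A meromorphic function on a half-plane that is invariant under a vertical translation on a
smaller half-plane is invariant, up to a discrete set. -/
theorem eventuallyEq_comp_add_of_meromorphicAt {Z : ℂ → ℂ} {σ a : ℝ} {w : ℂ} (hw : w.re = 0)
    (hmer : ∀ s : ℂ, σ < s.re → MeromorphicAt Z s)
    (hper : ∀ s : ℂ, a < s.re → Z (s + w) = Z s) {s : ℂ} (hs : σ < s.re) :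
    (fun t => Z (t + w)) =ᶠ[nhdsWithin s {s}ᶜ] Z := by
  set U : Set ℂ := {s | σ < s.re} with hU
  have hmerF : MeromorphicOn (fun t => Z (t + w) - Z t) U := by
    intro t ht
    have h1 : MeromorphicAt Z (t + w) := hmer _ (by
      rw [Complex.add_re, hw, add_zero]; exact ht)
    exact (h1.comp_analyticAt (g := fun t => t + w) (by fun_prop)).fun_sub (hmer t ht)
  have hconv : IsPreconnected U := (convex_halfSpace_re_gt σ).isPreconnected
  have htop : meromorphicOrderAt (fun t => Z (t + w) - Z t) s = ⊤ := by
    by_contra hne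
    have hyU : ((max σ a + 1 : ℝ) : ℂ) ∈ U := by
      change σ < (((max σ a + 1 : ℝ) : ℂ)).re
      rw [Complex.ofReal_re]; linarith [le_max_left σ a]
    refine hmerF.meromorphicOrderAt_ne_top_of_isPreconnected hconv hs hyU hne ?_
    rw [meromorphicOrderAt_eq_top_iff]
    have ha : a < (((max σ a + 1 : ℝ) : ℂ)).re := by
      rw [Complex.ofReal_re]; linarith [le_max_right σ a]
    filter_upwards [mem_nhdsWithin_of_mem_nhds
      ((isOpen_lt continuous_const Complex.continuous_re).mem_nhds ha)] with t ht
    rw [hper t ht, sub_self]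
  filter_upwards [meromorphicOrderAt_eq_top_iff.1 htop] with t ht
  exact sub_eq_zero.1 ht

/-- Grouping a sum of powers according to the exponent. -/
theorem hasSum_ncard_fiber_mul_pow {X : Type*} {m : X → ℕ} {T z : ℂ}
    (h : HasSum (fun x => T ^ m x) z) :
    HasSum (fun M => ({x | m x = M}.ncard : ℂ) * T ^ M) z := by
  refine (h.tsum_fiberwise m).congr_fun fun M => ?_
  have h1 : ∀ x : m ⁻¹' {M}, T ^ m x = T ^ M := fun x => by rw [x.2]
  simp only [h1]
  rw [tsum_const, nsmul_eq_mul, Nat.card_coe_set_eq]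
  rfl

theorem cpow_neg_eq_exp_pow {q : ℝ} (hq : 0 < q) (m : ℕ) (s : ℂ) :
    ((q ^ m : ℝ) : ℂ) ^ (-s) = Complex.exp (-(Real.log q) * s) ^ m := by
  rw [Complex.cpow_def_of_ne_zero (by exact_mod_cast (pow_pos hq m).ne'), ← Complex.ofReal_log
    (pow_pos hq m).le, Real.log_pow, ← Complex.exp_nat_mul]
  congr 1
  push_cast
  ring

theorem one_sub_exp_eq_zero_iff {L : ℝ} (hL : 0 < L) (a θ : ℝ) (s : ℂ) :
    1 - Complex.exp (-L * (s - ((a : ℂ) + 2 * (Real.pi : ℂ) * Complex.I * (θ : ℂ) / (L : ℂ)))) = 0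
      ↔ ∃ m : ℤ, s = (a : ℂ) + 2 * (Real.pi : ℂ) * Complex.I * ((θ : ℂ) + (m : ℂ)) / (L : ℂ) := by
  have hLc : (L : ℂ) ≠ 0 := by exact_mod_cast hL.ne'
  rw [sub_eq_zero, eq_comm, Complex.exp_eq_one_iff]
  constructor
  · rintro ⟨m, hm⟩
    refine ⟨-m, ?_⟩
    push_cast
    field_simp at hm ⊢
    linear_combination -hm
  · rintro ⟨m, rfl⟩
    refine ⟨-m, ?_⟩
    push_cast
    field_simp
    ring

/-- A Tauberian theorem for height zeta functions over global function fields
(Theorem 2.4 of Herrero–Martínez–Montero). -/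
theorem stmt_0 (q a ε : ℝ) (hq : 1 < q) (ha : 0 < a) (hε : 0 < ε)
    (b : ℕ) (hb : 1 ≤ b)
    (X : Type*) [Countable X] (H : X → ℝ) (hH : ∀ x, ∃ m : ℕ, H x = q ^ m)
    (Z : ℂ → ℂ)
    -- the series defining the height zeta function converges absolutely on `Re s > a`
    (hconv : ∀ s : ℂ, a < s.re → Summable fun x : X => ‖(H x : ℂ) ^ (-s)‖)
    -- `Z` extends the height zeta function
    (hext : ∀ s : ℂ, a < s.re → Z s = ∑' x : X, (H x : ℂ) ^ (-s))
    -- `Z` is meromorphic on the half-plane `Re s ≥ a - ε`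
    (hmer : ∀ s : ℂ, a - ε ≤ s.re → MeromorphicAt Z s)
    (n : ℕ) (θ : Fin (n + 1) → ℝ)
    (hθ0 : θ 0 = 0) (hθmono : StrictMono θ) (hθlt : ∀ k, θ k < 1)
    -- (1) `Z` has a pole of order `b` at `s = a`
    (hpole : HasPoleOfOrder Z b (a : ℂ))
    -- (2) `Z` is holomorphic at every `s` with `Re s > a - ε` which is not of the form
    -- `a + 2πi(θ k + m)/log q`
    (hhol : ∀ s : ℂ, a - ε < s.re →
      (∀ (k : Fin (n + 1)) (m : ℤ),
        s ≠ (a : ℂ) + 2 * (Real.pi : ℂ) * Complex.I * ((θ k : ℂ) + (m : ℂ)) / (Real.log q : ℂ)) →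
      AnalyticAt ℂ Z s)
    -- (3) at each `s_k = a + 2πiθ_k/log q`, `k ≠ 0`, `Z` is holomorphic or has a pole of
    -- order at most `b`
    (hle : ∀ k : Fin (n + 1), k ≠ 0 →
      HolomorphicOrPoleOfOrderLe Z b
        ((a : ℂ) + 2 * (Real.pi : ℂ) * Complex.I * (θ k : ℂ) / (Real.log q : ℂ))) :
    (∀ M : ℕ, {x : X | H x = q ^ M}.Finite) ∧
    ∃ (r : Fin (n + 1) → ℂ) (Q : Fin (n + 1) → Polynomial ℂ),
      -- `r k` is the limit of `(s - s_k) ^ b * Z s` as `s → s_k`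
      (∀ k : Fin (n + 1),
        Tendsto
          (fun s : ℂ =>
            (s - ((a : ℂ) + 2 * (Real.pi : ℂ) * Complex.I * (θ k : ℂ) / (Real.log q : ℂ))) ^ b
              * Z s)
          (nhdsWithin ((a : ℂ) + 2 * (Real.pi : ℂ) * Complex.I * (θ k : ℂ) / (Real.log q : ℂ))
            {(a : ℂ) + 2 * (Real.pi : ℂ) * Complex.I * (θ k : ℂ) / (Real.log q : ℂ)}ᶜ)
          (nhds (r k))) ∧
      -- `Q k` has degree at most `b - 1` and coefficient of `M ^ (b-1)` equal to `r k`
      (∀ k, (Q k).degree ≤ (b - 1 : ℕ)) ∧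
      (∀ k, (Q k).coeff (b - 1) = r k) ∧
      -- the asymptotic formula with error term `O(q^{δM})` for every `δ > a - ε`
      (∀ δ : ℝ, a - ε < δ →
        (fun M : ℕ =>
            ({x : X | H x = q ^ M}.ncard : ℂ) -
              (((Real.log q) ^ b / (Nat.factorial (b - 1) : ℝ) : ℝ) : ℂ)
                * ((q ^ (a * (M : ℝ)) : ℝ) : ℂ)
                * ∑ k : Fin (n + 1),
                    Complex.exp (2 * (Real.pi : ℂ) * Complex.I * (θ k : ℂ) * (M : ℂ))
                      * (Q k).eval (M : ℂ))
          =O[atTop] fun M : ℕ => (q ^ (δ * (M : ℝ)) : ℝ)) := by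
  classical
  have hq0 : 0 < q := by linarith
  set L := Real.log q with hLdef
  have hL : 0 < L := Real.log_pos hq
  have hLc : (L : ℂ) ≠ 0 := by exact_mod_cast hL.ne'
  set σ := a - ε with hσ
  have hσa : σ < a := by rw [hσ]; linarith
  choose m hm using hH
  have hinj : ∀ x M, H x = q ^ M ↔ m x = M := fun x M => by
    rw [hm x]; exact pow_right_inj₀ hq0 hq.ne'
  have hset : ∀ M : ℕ, {x : X | H x = q ^ M} = {x | m x = M} := fun M => by
    ext x; exact hinj x M
  have hterm : ∀ x s, (H x : ℂ) ^ (-s) = Complex.exp (-L * s) ^ m x := fun x s => by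
    rw [hm x, cpow_neg_eq_exp_pow hq0]
  -- the Dirichlet series as a power series
  have hser : ∀ s : ℂ, a < s.re →
      HasSum (fun M => ({x | m x = M}.ncard : ℂ) * Complex.exp (-L * s) ^ M) (Z s) := by
    intro s hs
    apply hasSum_ncard_fiber_mul_pow
    have h1 := (hconv s hs).of_norm.hasSum
    rw [← hext s hs] at h1
    simpa only [hterm] using h1
  have hfin : ∀ M : ℕ, {x : X | H x = q ^ M}.Finite := by
    intro M
    by_contra hinf
    have : Infinite {x : X | H x = q ^ M} := Set.infinite_coe_iff.2 hinf
    have h1 := (hconv ((a + 1 : ℝ) : ℂ) (by rw [Complex.ofReal_re]; linarith)).subtype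
      {x : X | H x = q ^ M}
    have h2 : Summable fun _ : {x : X | H x = q ^ M} =>
        ‖Complex.exp (-L * ((a + 1 : ℝ) : ℂ)) ^ M‖ := by
      refine h1.congr fun x => ?_
      rw [Function.comp_apply, hterm, (hinj x.1 M).1 x.2]
    rw [summable_const_iff, norm_eq_zero] at h2
    exact pow_ne_zero _ (Complex.exp_ne_zero _) h2
  refine ⟨hfin, ?_⟩
  set S : Fin (n + 1) → ℂ := fun k =>
    (a : ℂ) + 2 * (Real.pi : ℂ) * Complex.I * (θ k : ℂ) / (L : ℂ) with hS
  have hSre : ∀ k, (S k).re = a := fun k => by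
    have : S k = (a : ℂ) + ((2 * Real.pi * θ k / L : ℝ) : ℂ) * Complex.I := by
      rw [hS]; push_cast; ring
    rw [this]; simp
  have hpoleS : ∀ k, ∃ g : ℂ → ℂ, AnalyticAt ℂ g (S k) ∧
      ∀ᶠ s in nhdsWithin (S k) {S k}ᶜ, Z s = g s / (s - S k) ^ b := by
    intro k
    by_cases hk : k = 0
    · have : S k = a := by simp [hS, hk, hθ0]
      rw [this]
      obtain ⟨g, hg, -, h⟩ := hpole
      exact ⟨g, hg, h⟩
    · exact hle k hk
  choose g hg hgZ using hpoleS
  choose c f hc0 hf hcf using fun k => exists_principal_part hL (hg k) (hgZ k)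
  choose p hpdeg hpcoeff hpeval using exists_polynomial_eval_eq_choose
  -- `Z` minus its principal parts
  set u : Fin (n + 1) → ℂ → ℂ := fun k s => 1 - Complex.exp (-L * (s - S k)) with hu
  set P : Fin (n + 1) → ℂ → ℂ := fun k s => ∑ j ∈ Finset.range b, c k j / u k s ^ (b - j) with hP
  have hPan : ∀ k s, u k s ≠ 0 → AnalyticAt ℂ (P k) s := by
    intro k s hs
    have hua : AnalyticAt ℂ (u k) s := by fun_prop
    exact Finset.analyticAt_fun_sum _ fun j _ =>
      analyticAt_const.div (hua.pow _) (pow_ne_zero _ hs)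
  set F : ℂ → ℂ := fun s => Z s - ∑ k, P k s with hF
  have hFan : ∀ s : ℂ, σ < s.re → (∀ k, u k s ≠ 0) → AnalyticAt ℂ F s := by
    intro s hs hus
    refine AnalyticAt.fun_sub (hhol s hs fun k l hkl => hus k ?_)
      (Finset.analyticAt_fun_sum _ fun k _ => hPan k s (hus k))
    exact (one_sub_exp_eq_zero_iff hL a (θ k) s).2 ⟨l, hkl⟩
  have hwre : ∀ l : ℤ, ((l : ℂ) * (2 * (Real.pi : ℂ) * Complex.I / (L : ℂ))).re = 0 := fun l => by
    have : (l : ℂ) * (2 * (Real.pi : ℂ) * Complex.I / (L : ℂ))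
        = ((l * (2 * Real.pi / L) : ℝ) : ℂ) * Complex.I := by push_cast; ring
    rw [this]; simp
  have hexpper : ∀ (l : ℤ) (s t : ℂ),
      Complex.exp (-L * (s + (l : ℂ) * (2 * (Real.pi : ℂ) * Complex.I / (L : ℂ)) - t))
        = Complex.exp (-L * (s - t)) := fun l s t => by
    rw [Complex.exp_eq_exp_iff_exists_int]
    refine ⟨-l, ?_⟩
    push_cast
    field_simp
    ring
  have hZper : ∀ (l : ℤ) (s : ℂ), a < s.re →
      Z (s + (l : ℂ) * (2 * (Real.pi : ℂ) * Complex.I / (L : ℂ))) = Z s := by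
    intro l s hs
    have h1 := hser (s + (l : ℂ) * (2 * (Real.pi : ℂ) * Complex.I / (L : ℂ)))
      (by rw [Complex.add_re, hwre, add_zero]; exact hs)
    have h2 := hexpper l s 0
    rw [sub_zero, sub_zero] at h2
    rw [h2] at h1
    exact h1.unique (hser s hs)
  have hFper : ∀ (l : ℤ) (s : ℂ), σ < s.re →
      (fun t => F (t + (l : ℂ) * (2 * (Real.pi : ℂ) * Complex.I / (L : ℂ))))
        =ᶠ[nhdsWithin s {s}ᶜ] F := by
    intro l s hs
    filter_upwards [eventuallyEq_comp_add_of_meromorphicAt (hwre l)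
      (fun s hs => hmer s hs.le) (hZper l) hs] with t ht
    simp only [hF, hP, hu, hexpper, ht]
  have huS : ∀ j k, j ≠ k → u j (S k) ≠ 0 := by
    intro j k hjk h0
    obtain ⟨l, hl⟩ := (one_sub_exp_eq_zero_iff hL a (θ j) (S k)).1 h0
    have hθn : ∀ i, 0 ≤ θ i := fun i => hθ0 ▸ hθmono.monotone (Fin.zero_le i)
    have h2 : (θ k : ℂ) = (θ j : ℂ) + (l : ℂ) := by
      have hpi : (Real.pi : ℂ) ≠ 0 := by exact_mod_cast Real.pi_ne_zero
      have hI := Complex.I_ne_zero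
      simp only [hS] at hl
      field_simp at hl
      have h3 : (2 * (Real.pi : ℂ) * Complex.I) * (θ k : ℂ)
          = (2 * (Real.pi : ℂ) * Complex.I) * ((θ j : ℂ) + (l : ℂ)) := by
        linear_combination hl
      exact mul_left_cancel₀ (by simp [hpi]) h3
    have h3 : θ k = θ j + l := by exact_mod_cast h2
    have h4 : (l : ℝ) < 1 := by linarith [hθn j, hθlt k]
    have h5 : (-1 : ℝ) < l := by linarith [hθn k, hθlt j]
    have h6 : l = 0 := by
      have : l < 1 := by exact_mod_cast h4
      have : -1 < l := by exact_mod_cast h5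
      omega
    rw [h6, Int.cast_zero, add_zero] at h3
    exact hjk (hθmono.injective h3.symm)
  have hFS : ∀ k, ∃ φ : ℂ → ℂ, AnalyticAt ℂ φ (S k) ∧ F =ᶠ[nhdsWithin (S k) {S k}ᶜ] φ := by
    intro k
    refine ⟨fun s => f k s - ∑ j ∈ Finset.univ.erase k, P j s, AnalyticAt.fun_sub (hf k)
      (Finset.analyticAt_fun_sum _ fun j hj => hPan j _ (huS j k (Finset.ne_of_mem_erase hj))), ?_⟩
    filter_upwards [hcf k] with s hs
    rw [← hs]
    simp only [hF]
    rw [← Finset.add_sum_erase _ _ (Finset.mem_univ k), sub_add_eq_sub_sub]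
  have hFloc : ∀ s ∈ {s : ℂ | σ < s.re}, ∃ φ : ℂ → ℂ, AnalyticAt ℂ φ s ∧
      F =ᶠ[nhdsWithin s {s}ᶜ] φ := by
    intro s hs
    by_cases hus : ∀ k, u k s ≠ 0
    · exact ⟨F, hFan s hs hus, EventuallyEq.rfl⟩
    · push Not at hus
      obtain ⟨k, hk⟩ := hus
      obtain ⟨l, hl⟩ := (one_sub_exp_eq_zero_iff hL a (θ k) s).1 hk
      obtain ⟨φ, hφ, hFφ⟩ := hFS k
      set w : ℂ := ((-l : ℤ) : ℂ) * (2 * (Real.pi : ℂ) * Complex.I / (L : ℂ)) with hw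
      have hsw : s + w = S k := by
        rw [hl, hw, hS]; push_cast; ring
      refine ⟨fun t => φ (t + w), ?_, ?_⟩
      · rw [← hsw] at hφ
        exact hφ.comp (f := fun t => t + w) (by fun_prop)
      · have htend : Tendsto (fun t => t + w) (nhdsWithin s {s}ᶜ) (nhdsWithin (S k) {S k}ᶜ) := by
          refine tendsto_nhdsWithin_iff.2 ⟨?_, ?_⟩
          · rw [← hsw]
            exact ((continuous_id.add continuous_const).tendsto s).mono_left nhdsWithin_le_nhds
          · filter_upwards [self_mem_nhdsWithin] with t ht
            rw [← hsw]
            exact fun h => ht (add_right_cancel h)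
        exact (hFper (-l) s hs).symm.trans (htend.eventually hFφ)
  have hopen : IsOpen {s : ℂ | σ < s.re} := isOpen_lt continuous_const Complex.continuous_re
  obtain ⟨G, hG⟩ := exists_analyticAt_eventuallyEq_nhdsNE hopen hFloc
  have hGF : ∀ s : ℂ, a < s.re → F s = G s := by
    intro s hs
    have hs' : σ < s.re := hσa.trans hs
    have hus : ∀ k, u k s ≠ 0 := by
      intro k h0
      obtain ⟨l, hl⟩ := (one_sub_exp_eq_zero_iff hL a (θ k) s).1 h0
      have h1 : s = S k + (l : ℂ) * (2 * (Real.pi : ℂ) * Complex.I / (L : ℂ)) := by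
        rw [hl, hS]; ring
      rw [h1, Complex.add_re, hwre, hSre, add_zero] at hs
      exact lt_irrefl _ hs
    exact (((hFan s hs' hus).continuousAt.eventuallyEq_nhds_iff_eventuallyEq_nhdsNE
      (hG s hs').1.continuousAt).1 (hG s hs').2).eq_of_nhds
  have hGper : ∀ s : ℂ, σ < s.re → G (s + 2 * (Real.pi : ℂ) * Complex.I / (L : ℂ)) = G s := by
    intro s hs
    set w : ℂ := 2 * (Real.pi : ℂ) * Complex.I / (L : ℂ) with hw
    have hw1 : ((1 : ℤ) : ℂ) * w = w := by simp
    have hsw : σ < (s + w).re := by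
      have := hwre 1
      rw [hw1] at this
      rw [Complex.add_re, this, add_zero]; exact hs
    have h1 := hFper 1 s hs
    rw [hw1] at h1
    have htend : Tendsto (fun t => t + w) (nhdsWithin s {s}ᶜ) (nhdsWithin (s + w) {s + w}ᶜ) := by
      refine tendsto_nhdsWithin_iff.2 ⟨?_, ?_⟩
      · exact ((continuous_id.add continuous_const).tendsto s).mono_left nhdsWithin_le_nhds
      · filter_upwards [self_mem_nhdsWithin] with t ht
        exact fun h => ht (add_right_cancel h)
    have h2 : (fun t => G (t + w)) =ᶠ[nhdsWithin s {s}ᶜ] G :=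
      (((hG _ hsw).2.comp_tendsto htend).symm.trans h1).trans (hG s hs).2
    have hcont : ContinuousAt (fun t => G (t + w)) s :=
      ContinuousAt.comp (f := fun t => t + w) (g := G) (hG _ hsw).1.continuousAt (by fun_prop)
    exact ((hcont.eventuallyEq_nhds_iff_eventuallyEq_nhdsNE (hG s hs).1.continuousAt).1
      h2).eq_of_nhds
  obtain ⟨h, hhd, hhG⟩ := exists_differentiableAt_comp_exp hL
    (fun s hs => (hG s hs).1.differentiableAt) hGper
  -- coefficients of the remainder
  set d : ℕ → ℂ := fun M => ({x | m x = M}.ncard : ℂ) - ∑ k, ∑ j ∈ Finset.range b,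
    c k j * (((M + (b - 1 - j)).choose (b - 1 - j) : ℂ) * Complex.exp (L * S k) ^ M) with hd
  have hdsum : ∀ T : ℂ, T ≠ 0 → ‖T‖ < Real.exp (-L * a) →
      HasSum (fun M => d M * T ^ M) (h T) := by
    intro T hT hTn
    obtain ⟨s, rfl⟩ : ∃ s, Complex.exp (-L * s) = T :=
      ⟨-Complex.log T / L, by
        rw [neg_mul, mul_div_cancel₀ _ hLc, neg_neg, Complex.exp_log hT]⟩
    have hs : a < s.re := by
      rw [Complex.norm_exp, Real.exp_lt_exp] at hTn
      simp at hTn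
      nlinarith
    rw [hhG s (hσa.trans hs), ← hGF s hs]
    simp only [hd, hF, hP, sub_mul, Finset.sum_mul]
    refine (hser s hs).sub (hasSum_sum fun k _ => hasSum_sum fun j hj => ?_)
    have hlt : ‖Complex.exp (-L * (s - S k))‖ < 1 := by
      rw [Complex.norm_exp, Real.exp_lt_one_iff]
      simp [hSre]
      nlinarith
    have h1 := (hasSum_choose_mul_geometric_of_norm_lt_one (b - 1 - j) hlt).mul_left (c k j)
    have hj' : b - 1 - j + 1 = b - j := by have := Finset.mem_range.1 hj; omega
    rw [hj', mul_one_div] at h1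
    refine h1.congr_fun fun M => ?_
    have : Complex.exp (-L * (s - S k)) = Complex.exp (L * S k) * Complex.exp (-L * s) := by
      rw [← Complex.exp_add]; congr 1; ring
    rw [this, mul_pow]
    ring
  have hfac : ((b - 1).factorial : ℂ) ≠ 0 := by exact_mod_cast (b - 1).factorial_ne_zero
  refine ⟨fun k => g k (S k), fun k => ∑ j ∈ Finset.range b,
    Polynomial.C (((b - 1).factorial : ℂ) / (L : ℂ) ^ b * c k j) * p (b - 1 - j), ?_, ?_, ?_, ?_⟩
  · intro k
    refine ((hg k).continuousAt.tendsto.mono_left nhdsWithin_le_nhds).congr' ?_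
    filter_upwards [hgZ k, self_mem_nhdsWithin] with s hs hsk
    have : s - S k ≠ 0 := sub_ne_zero.2 hsk
    rw [hs, mul_div_cancel₀ _ (pow_ne_zero _ this)]
  · intro k
    refine (Polynomial.degree_sum_le _ _).trans (Finset.sup_le fun j _ => ?_)
    refine Polynomial.degree_le_of_natDegree_le ((Polynomial.natDegree_C_mul_le _ _).trans ?_)
    rw [hpdeg]
    omega
  · intro k
    rw [Polynomial.finsetSum_coeff, Finset.sum_eq_single 0]
    · rw [Polynomial.coeff_C_mul, Nat.sub_zero, hpcoeff, hc0]
      field_simp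
    · intro j hj hj0
      rw [Polynomial.coeff_C_mul, Polynomial.coeff_eq_zero_of_natDegree_lt, mul_zero]
      have := Finset.mem_range.1 hj
      rw [hpdeg]
      omega
    · intro h0
      exact absurd (Finset.mem_range.2 hb) h0
  · intro δ hδ
    obtain ⟨C, hC⟩ := exists_norm_coeff_mul_pow_le (Real.exp_pos _) hdsum hhd
      (Real.exp_pos (-L * δ)) (by rw [Real.exp_lt_exp]; nlinarith)
    refine Asymptotics.IsBigO.of_bound C (Eventually.of_forall fun M => ?_)
    have hqpow : ∀ y : ℝ, q ^ (y * (M : ℝ)) = Real.exp (L * y) ^ M := fun y => by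
      rw [Real.rpow_def_of_pos hq0, ← Real.exp_nat_mul]; congr 1; ring
    have hρ : Real.exp (-L * δ) ^ M * Real.exp (L * δ) ^ M = 1 := by
      rw [← mul_pow, ← Real.exp_add]; simp
    have hpos : 0 < Real.exp (L * δ) ^ M := by positivity
    rw [hqpow δ, Real.norm_of_nonneg hpos.le]
    have hdM : ‖d M‖ ≤ C * Real.exp (L * δ) ^ M := by
      calc ‖d M‖ = ‖d M‖ * Real.exp (-L * δ) ^ M * Real.exp (L * δ) ^ M := by
            rw [mul_assoc, hρ, mul_one]
        _ ≤ _ := mul_le_mul_of_nonneg_right (hC M) hpos.le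
    convert hdM using 2
    rw [hset M, hqpow a]
    simp only [hd]
    congr 1
    rw [Finset.mul_sum]
    refine Finset.sum_congr rfl fun k _ => ?_
    have hexpS : Complex.exp (L * S k) ^ M = ((Real.exp (L * a) ^ M : ℝ) : ℂ)
        * Complex.exp (2 * (Real.pi : ℂ) * Complex.I * (θ k : ℂ) * (M : ℂ)) := by
      push_cast
      rw [← Complex.exp_nat_mul, ← Complex.exp_nat_mul, ← Complex.exp_add, hS]
      congr 1
      field_simp
    rw [Polynomial.eval_finsetSum, Finset.mul_sum, Finset.mul_sum]
    refine Finset.sum_congr rfl fun j _ => ?_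
    rw [Polynomial.eval_mul, Polynomial.eval_C, hpeval, hexpS]
    push_cast
    field_simp
end

section
/- Assume moreover a_r > 0. Consider the map φ : K^d → ℙ^{rt}(K) × ℙ^{t−1}(K) defined by φ(x₁,…,x_d) = ([x_d : (x̃_{ij})_{1≤i≤t, 1≤j≤r}], [x₁ : … : x_{t−1} : 1]), where x̃_{ij} = x_{t+j−1}·x_i^{a_j} if i < t and j < r; x̃_{ij} = x_{t+j−1} if i = t and j < r; x̃_{ij} = x_i^{a_r} if i < t and j = r; and x̃_{tr} = 1. Then φ is injective, every point in the image of φ satisfies the defining equations of X_d(a₁,…,a_r), and the image of φ is exactly the set of K-points of the good open subset U_d(a₁,…,a_r), i.e. the K-points of X_d(a₁,…,a_r) with x_{tr} ≠ 0. -/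
noncomputable section

variable (K : Type*) [Field K]

/-- The `x`-part of the parametrization `φ` of the good open subset of
`X_d(a₁,…,a_r)`, with `r = r' + 1`, `t = t' + 2` and `d = r + t - 1 = r' + t' + 2`.
Homogeneous coordinates on `ℙ^{rt}` are indexed by `Option (Fin t × Fin r)`,
with `none` corresponding to `x₀` and `some (i, j)` to `x_{(i+1)(j+1)}`. -/
def phiX (r' t' : ℕ) (a : Fin (r' + 1) → ℕ) (v : Fin (r' + t' + 2) → K) :
    Option (Fin (t' + 2) × Fin (r' + 1)) → K := fun o =>
  match o with
  | none => v (Fin.last (r' + t' + 1))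
  | some (i, j) =>
      if hi : (i : ℕ) < t' + 1 then
        if hj : (j : ℕ) < r' then
          v ⟨t' + 1 + (j : ℕ), by omega⟩ * v ⟨(i : ℕ), by omega⟩ ^ a j
        else
          v ⟨(i : ℕ), by omega⟩ ^ a j
      else
        if hj : (j : ℕ) < r' then v ⟨t' + 1 + (j : ℕ), by omega⟩ else 1

/-- The `y`-part of the parametrization `φ`: the point `[x₁ : … : x_{t-1} : 1]`. -/
def phiY (r' t' : ℕ) (v : Fin (r' + t' + 2) → K) : Fin (t' + 2) → K := fun i =>
  if hi : (i : ℕ) < t' + 1 then v ⟨(i : ℕ), by omega⟩ else 1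

lemma phiX_ne_zero (r' t' : ℕ) (a : Fin (r' + 1) → ℕ) (v : Fin (r' + t' + 2) → K) :
    phiX K r' t' a v ≠ 0 := by
  intro h
  have h1 := congrFun h (some (Fin.last (t' + 1), Fin.last r'))
  simp [phiX] at h1

lemma phiY_ne_zero (r' t' : ℕ) (v : Fin (r' + t' + 2) → K) : phiY K r' t' v ≠ 0 := by
  intro h
  have h1 := congrFun h (Fin.last (t' + 1))
  simp [phiY] at h1

/-- The map `φ : K^d → ℙ^{rt}(K) × ℙ^{t-1}(K)` parametrizing the good open subset
of the Hirzebruch–Kleinschmidt variety `X_d(a₁,…,a_r)`. -/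
def phiHK (r' t' : ℕ) (a : Fin (r' + 1) → ℕ) (v : Fin (r' + t' + 2) → K) :
    Projectivization K (Option (Fin (t' + 2) × Fin (r' + 1)) → K) ×
      Projectivization K (Fin (t' + 2) → K) :=
  (Projectivization.mk K (phiX K r' t' a v) (phiX_ne_zero K r' t' a v),
    Projectivization.mk K (phiY K r' t' v) (phiY_ne_zero K r' t' v))

/-- The set of `K`-points of the Hirzebruch–Kleinschmidt variety `X_d(a₁,…,a_r)`
inside `ℙ^{rt}(K) × ℙ^{t-1}(K)`: the defining equations are
`x_{mj} y_n^{a_j} = x_{nj} y_m^{a_j}` for all `j` and all `m ≠ n` (the equations are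
bihomogeneous, so testing them on the chosen representatives `rep` is equivalent to
testing them on any representatives). -/
def HKPoints (r' t' : ℕ) (a : Fin (r' + 1) → ℕ) :
    Set (Projectivization K (Option (Fin (t' + 2) × Fin (r' + 1)) → K) ×
      Projectivization K (Fin (t' + 2) → K)) :=
  {p | ∀ (j : Fin (r' + 1)) (m n : Fin (t' + 2)), m ≠ n →
    p.1.rep (some (m, j)) * p.2.rep n ^ a j = p.1.rep (some (n, j)) * p.2.rep m ^ a j}

/-- The set of `K`-points of the good open subset `U_d(a₁,…,a_r)`: the `K`-points of
`X_d(a₁,…,a_r)` with `x_{tr} ≠ 0`. -/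
def HKGoodPoints (r' t' : ℕ) (a : Fin (r' + 1) → ℕ) :
    Set (Projectivization K (Option (Fin (t' + 2) × Fin (r' + 1)) → K) ×
      Projectivization K (Fin (t' + 2) → K)) :=
  {p ∈ HKPoints K r' t' a | p.1.rep (some (Fin.last (t' + 1), Fin.last r')) ≠ 0}

lemma phiX_some (r' t' : ℕ) (a : Fin (r' + 1) → ℕ) (v : Fin (r' + t' + 2) → K)
    (i : Fin (t' + 2)) (j : Fin (r' + 1)) :
    phiX K r' t' a v (some (i, j)) =
      phiX K r' t' a v (some (Fin.last (t' + 1), j)) * phiY K r' t' v i ^ a j := by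
  by_cases hi : (i : ℕ) < t' + 1 <;> by_cases hj : (j : ℕ) < r' <;> simp [phiX, phiY, hi, hj]

lemma phiX_last_last (r' t' : ℕ) (a : Fin (r' + 1) → ℕ) (v : Fin (r' + t' + 2) → K) :
    phiX K r' t' a v (some (Fin.last (t' + 1), Fin.last r')) = 1 := by
  simp [phiX]

lemma phiY_last (r' t' : ℕ) (v : Fin (r' + t' + 2) → K) :
    phiY K r' t' v (Fin.last (t' + 1)) = 1 := by
  simp [phiY]

lemma eq_of_phiX_eq_of_phiY_eq {r' t' : ℕ} {a : Fin (r' + 1) → ℕ}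
    {v w : Fin (r' + t' + 2) → K} (hX : phiX K r' t' a v = phiX K r' t' a w)
    (hY : phiY K r' t' v = phiY K r' t' w) : v = w := by
  ext ⟨k, hk⟩
  rcases lt_or_ge k (t' + 1) with h1 | h1
  · simpa [phiY, h1] using congrFun hY ⟨k, by omega⟩
  rcases lt_or_ge k (t' + 1 + r') with h2 | h2
  · obtain ⟨j, rfl⟩ := Nat.exists_eq_add_of_le h1
    have hj : j < r' := by omega
    simpa [phiX, hj] using congrFun hX (some (Fin.last (t' + 1), ⟨j, by omega⟩))
  · obtain rfl : k = r' + t' + 1 := by omega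
    exact congrFun hX none

lemma Projectivization.eq_of_mk_eq_mk_of_apply_eq_one {ι : Type*} {x y : ι → K}
    {hx : x ≠ 0} {hy : y ≠ 0} (h : Projectivization.mk K x hx = Projectivization.mk K y hy)
    (i : ι) (hxi : x i = 1) (hyi : y i = 1) : x = y := by
  obtain ⟨c, hc⟩ := (Projectivization.mk_eq_mk_iff' K x y hx hy).1 h
  have hc1 : c = 1 := by simpa [hxi, hyi] using congrFun hc i
  simpa [hc1] using hc.symm

lemma phiHK_injective (r' t' : ℕ) (a : Fin (r' + 1) → ℕ) :
    Function.Injective (phiHK K r' t' a) := fun v w h =>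
  eq_of_phiX_eq_of_phiY_eq K
    (Projectivization.eq_of_mk_eq_mk_of_apply_eq_one K (congrArg Prod.fst h) _
      (phiX_last_last K r' t' a v) (phiX_last_last K r' t' a w))
    (Projectivization.eq_of_mk_eq_mk_of_apply_eq_one K (congrArg Prod.snd h) _
      (phiY_last K r' t' v) (phiY_last K r' t' w))

lemma phiHK_mem_HKGoodPoints (r' t' : ℕ) (a : Fin (r' + 1) → ℕ) (v : Fin (r' + t' + 2) → K) :
    phiHK K r' t' a v ∈ HKGoodPoints K r' t' a := by
  obtain ⟨b, hb⟩ := Projectivization.exists_smul_eq_mk_rep K _ (phiX_ne_zero K r' t' a v)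
  obtain ⟨c, hc⟩ := Projectivization.exists_smul_eq_mk_rep K _ (phiY_ne_zero K r' t' v)
  refine ⟨fun j m n _ => ?_, ?_⟩
  · simp only [phiHK, ← hb, ← hc, Pi.smul_apply, Units.smul_def, smul_eq_mul]
    rw [phiX_some K r' t' a v m j, phiX_some K r' t' a v n j]
    ring
  · simp [phiHK, ← hb, Units.smul_def, phiX_last_last]

/-- On the good open subset, the last coordinate of the `y`-part does not vanish. -/
lemma rep_snd_last_ne_zero {r' t' : ℕ} {a : Fin (r' + 1) → ℕ} (har : 0 < a (Fin.last r'))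
    {p : Projectivization K (Option (Fin (t' + 2) × Fin (r' + 1)) → K) ×
      Projectivization K (Fin (t' + 2) → K)} (hp : p ∈ HKGoodPoints K r' t' a) :
    p.2.rep (Fin.last (t' + 1)) ≠ 0 := by
  intro h0
  refine p.2.rep_nonzero (funext fun n => ?_)
  by_cases hn : n = Fin.last (t' + 1)
  · simpa [hn] using h0
  · have h := hp.1 (Fin.last r') (Fin.last (t' + 1)) n (Ne.symm hn)
    rw [h0, zero_pow har.ne', mul_zero] at h
    exact eq_zero_of_pow_eq_zero ((mul_eq_zero.1 h).resolve_left hp.2)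

lemma exists_phiX_phiY_eq {r' t' : ℕ} {a : Fin (r' + 1) → ℕ}
    {x : Option (Fin (t' + 2) × Fin (r' + 1)) → K} {y : Fin (t' + 2) → K}
    (hx : x (some (Fin.last (t' + 1), Fin.last r')) = 1) (hy : y (Fin.last (t' + 1)) = 1)
    (hxy : ∀ i j, x (some (i, j)) = x (some (Fin.last (t' + 1), j)) * y i ^ a j) :
    ∃ v, phiX K r' t' a v = x ∧ phiY K r' t' v = y := by
  let v : Fin (r' + t' + 2) → K := fun k =>
    if h1 : (k : ℕ) < t' + 1 then y ⟨k, by omega⟩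
    else if h2 : (k : ℕ) < t' + 1 + r' then
      x (some (Fin.last (t' + 1), ⟨(k : ℕ) - (t' + 1), by omega⟩))
    else x none
  have hY : phiY K r' t' v = y := by
    ext i
    by_cases hi : (i : ℕ) < t' + 1
    · simp only [phiY, v, hi, dite_true]
    · obtain rfl : i = Fin.last (t' + 1) := Fin.ext (by simp; omega)
      rw [phiY_last, hy]
  have hlast (j : Fin (r' + 1)) : phiX K r' t' a v (some (Fin.last (t' + 1), j)) =
      x (some (Fin.last (t' + 1), j)) := by
    by_cases hj : (j : ℕ) < r'
    · have h1 : ¬ t' + 1 + (j : ℕ) < t' + 1 := by omega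
      simp [phiX, v, hj, h1, -Order.lt_add_one_iff]
    · obtain rfl : j = Fin.last r' := Fin.ext (by simp; omega)
      rw [phiX_last_last, hx]
  refine ⟨v, funext fun o => ?_, hY⟩
  match o with
  | none =>
    have h1 : ¬ r' + t' + 1 < t' + 1 := by omega
    have h2 : ¬ r' + t' + 1 < t' + 1 + r' := by omega
    simp only [phiX, v, Fin.val_last, h1, h2, dite_false]
  | some (i, j) => rw [phiX_some, hlast, hY, hxy i j]

lemma HKGoodPoints_subset_range_phiHK {r' t' : ℕ} {a : Fin (r' + 1) → ℕ}
    (har : 0 < a (Fin.last r')) :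
    HKGoodPoints K r' t' a ⊆ Set.range (phiHK K r' t' a) := by
  intro p hp
  have hc := hp.2
  have he := rep_snd_last_ne_zero K har hp
  set c := p.1.rep (some (Fin.last (t' + 1), Fin.last r')) with hc_def
  set e := p.2.rep (Fin.last (t' + 1)) with he_def
  obtain ⟨v, hX, hY⟩ := exists_phiX_phiY_eq K (a := a) (x := c⁻¹ • p.1.rep) (y := e⁻¹ • p.2.rep)
    (by simp [← hc_def, hc]) (by simp [← he_def, he]) (fun i j => by
      have h : p.1.rep (some (i, j)) * e ^ a j =
          p.1.rep (some (Fin.last (t' + 1), j)) * p.2.rep i ^ a j := by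
        by_cases hi : i = Fin.last (t' + 1)
        · rw [hi]
        · exact hp.1 j i (Fin.last (t' + 1)) hi
      simp only [Pi.smul_apply, smul_eq_mul, mul_pow, inv_pow]
      field_simp
      exact h)
  refine ⟨v, Prod.ext ?_ ?_⟩
  · rw [← p.1.mk_rep]
    exact (Projectivization.mk_eq_mk_iff' K _ _ _ _).2 ⟨c⁻¹, hX.symm⟩
  · rw [← p.2.mk_rep]
    exact (Projectivization.mk_eq_mk_iff' K _ _ _ _).2 ⟨e⁻¹, hY.symm⟩

/-- For `r = r' + 1 ≥ 1`, `t = t' + 2 ≥ 2` and `0 ≤ a₁ ≤ ⋯ ≤ a_r` with `a_r > 0`,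
the map `φ` is injective, lands in `X_d(a₁,…,a_r)(K)`, and its image is exactly the
set of `K`-points of the good open subset `U_d(a₁,…,a_r)`. -/
theorem stmt_7 (r' t' : ℕ) (a : Fin (r' + 1) → ℕ) (hmono : Monotone a)
    (har : 0 < a (Fin.last r')) :
    Function.Injective (phiHK K r' t' a) ∧
    (∀ v : Fin (r' + t' + 2) → K, phiHK K r' t' a v ∈ HKPoints K r' t' a) ∧
    Set.range (phiHK K r' t' a) = HKGoodPoints K r' t' a := by
  exact ⟨phiHK_injective K r' t' a, fun v => (phiHK_mem_HKGoodPoints K r' t' a v).1,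
    (Set.range_subset_iff.2 (phiHK_mem_HKGoodPoints K r' t' a)).antisymm
      (HKGoodPoints_subset_range_phiHK K har)⟩

end
end

section
/- Assume that for every n ∈ ℕ the set {v ∈ V : f(v) ≤ n} is finite, so that for every n ∈ ℕ the set {D ∈ Div⁺ : deg D = n} is finite. For a nonzero complex number c, define F_c : Div⁺ → ℂ by F_c(D) = ∏_{v ∈ V, D(v) > 0} (1 − c^{−f(v)}). Then for every n ∈ ℕ one has c^n · #{D ∈ Div⁺ : deg D = n} = ∑_{k=0}^{n} #{D ∈ Div⁺ : deg D = n − k} · c^k · (∑_{D′ ∈ Div⁺, deg D′ = k} F_c(D′)); equivalently, with Z(T) = ∑_{D ∈ Div⁺} T^{deg D}, one has the formal identity Z(cT) = Z(T) · ∑_{D ∈ Div⁺} F_c(D) (cT)^{deg D}. -/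
/-- The degree of an effective divisor `D : V →₀ ℕ` with respect to the residue degrees
`f : V → ℕ`, namely `deg D = ∑ v, f v * D v`. -/
def HKdeg {V : Type*} (f : V → ℕ) (D : V →₀ ℕ) : ℕ :=
  D.sum fun v n => f v * n

/-- `F_c(D) = ∏_{v : D v > 0} (1 - c^{-f v})`. -/
noncomputable def HKFc {V : Type*} (f : V → ℕ) (c : ℂ) (D : V →₀ ℕ) : ℂ :=
  ∏ v ∈ D.support, (1 - c ^ (-(f v : ℤ)))

theorem HKdeg_add {V : Type*} (f : V → ℕ) (A B : V →₀ ℕ) :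
    HKdeg f (A + B) = HKdeg f A + HKdeg f B :=
  Finsupp.sum_add_index' (fun _ => mul_zero _) fun _ _ _ => mul_add _ _ _

theorem mul_le_HKdeg {V : Type*} (f : V → ℕ) (D : V →₀ ℕ) (v : V) :
    f v * D v ≤ HKdeg f D := by
  by_cases hv : v ∈ D.support
  · exact Finset.single_le_sum (f := fun v => f v * D v) (fun _ _ => Nat.zero_le _) hv
  · simp [Finsupp.notMem_support_iff.mp hv]

theorem finite_HKdeg_eq {V : Type*} (f : V → ℕ) (hf : ∀ v, 1 ≤ f v)
    (hfin : ∀ n : ℕ, {v : V | f v ≤ n}.Finite) (n : ℕ) :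
    {D : V →₀ ℕ | HKdeg f D = n}.Finite := by
  refine ((hfin n).toFinset.finsupp fun _ => Finset.range (n + 1)).finite_toSet.subset ?_
  rintro D rfl
  rw [Finset.mem_coe, Finset.mem_finsupp_iff]
  refine ⟨fun v hv => ?_, fun v _ => ?_⟩
  · rw [Set.Finite.mem_toFinset]
    exact (Nat.le_mul_of_pos_right _ (Nat.pos_of_ne_zero (Finsupp.mem_support_iff.mp hv))).trans
      (mul_le_HKdeg f D v)
  · rw [Finset.mem_range, Nat.lt_succ_iff]
    exact (Nat.le_mul_of_pos_left _ (hf v)).trans (mul_le_HKdeg f D v)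

theorem sum_range_ite_pow_mul_one_sub_inv {K : Type*} [Field K] {x : K} (hx : x ≠ 0) (n : ℕ) :
    ∑ m ∈ Finset.range (n + 1), (if m = 0 then 1 else x ^ m * (1 - x⁻¹)) = x ^ n := by
  induction n with
  | zero => simp
  | succ n ih =>
    rw [Finset.sum_range_succ, ih, if_neg n.succ_ne_zero]
    field_simp
    ring

/-- Summing a product of local factors over all `B ≤ D` gives the product of the local sums. -/
theorem sum_Iic_prod_eq_prod_sum_range {V R : Type*} [DecidableEq V] [CommSemiring R]
    (g : V → ℕ → R) (D : V →₀ ℕ) :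
    ∑ B ∈ Finset.Iic D, ∏ v ∈ D.support, g v (B v)
      = ∏ v ∈ D.support, ∑ m ∈ Finset.range (D v + 1), g v m := by
  have hIic : Finset.Iic D = D.support.finsupp fun v => Finset.range (D v + 1) := by
    ext B
    rw [Finset.mem_Iic, Finset.mem_finsupp_iff]
    refine ⟨fun h => ⟨Finsupp.support_mono h, fun v _ => ?_⟩, fun h v => ?_⟩
    · exact Finset.mem_range_succ_iff.mpr (h v)
    · by_cases hv : v ∈ D.support
      · exact Finset.mem_range_succ_iff.mp (h.2 v hv)
      · simp [Finsupp.notMem_support_iff.mp fun hB => hv (h.1 hB)]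
  rw [hIic, Finset.prod_sum, Finset.finsupp, Finset.sum_map]
  refine Finset.sum_congr (by congr!) fun p _ => ?_
  rw [← Finset.prod_attach]
  refine Finset.prod_congr rfl fun v _ => ?_
  simp [Finsupp.indicator_of_mem v.2]

theorem pow_HKdeg_mul_HKFc {V : Type*} (f : V → ℕ) (c : ℂ) {B : V →₀ ℕ} {s : Finset V}
    (hs : B.support ⊆ s) :
    c ^ HKdeg f B * HKFc f c B
      = ∏ v ∈ s, if B v = 0 then 1 else (c ^ f v) ^ B v * (1 - (c ^ f v)⁻¹) := by
  rw [← Finset.prod_subset hs fun v _ hv => if_pos (Finsupp.notMem_support_iff.mp hv),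
    HKdeg, HKFc, Finsupp.sum, ← Finset.prod_pow_eq_pow_sum, ← Finset.prod_mul_distrib]
  refine Finset.prod_congr rfl fun v hv => ?_
  rw [if_neg (Finsupp.mem_support_iff.mp hv), pow_mul, zpow_neg, zpow_natCast]

theorem sum_Iic_pow_HKdeg_mul_HKFc {V : Type*} [DecidableEq V] (f : V → ℕ) {c : ℂ} (hc : c ≠ 0)
    (D : V →₀ ℕ) :
    ∑ B ∈ Finset.Iic D, c ^ HKdeg f B * HKFc f c B = c ^ HKdeg f D := by
  rw [Finset.sum_congr rfl fun B hB =>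
      pow_HKdeg_mul_HKFc f c (Finsupp.support_mono (Finset.mem_Iic.mp hB)),
    sum_Iic_prod_eq_prod_sum_range
      fun v m => if m = 0 then 1 else (c ^ f v) ^ m * (1 - (c ^ f v)⁻¹)]
  simp_rw [sum_range_ite_pow_mul_one_sub_inv (pow_ne_zero _ hc), ← pow_mul]
  exact Finset.prod_pow_eq_pow_sum _ _ _

/-- The identity `Z(cT) = Z(T) · ∑_D F_c(D) (cT)^{deg D}` at the level of coefficients:
for every `n`,
`c^n · #{D : deg D = n} = ∑_{k=0}^{n} #{D : deg D = n-k} · c^k · (∑_{deg D' = k} F_c(D'))`. -/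
theorem stmt_9 {V : Type*} (f : V → ℕ) (hf : ∀ v, 1 ≤ f v)
    (hfin : ∀ n : ℕ, {v : V | f v ≤ n}.Finite) (c : ℂ) (hc : c ≠ 0) :
    ∀ n : ℕ,
      c ^ n * ({D : V →₀ ℕ | HKdeg f D = n}.ncard : ℂ)
        = ∑ k ∈ Finset.range (n + 1),
            ({D : V →₀ ℕ | HKdeg f D = n - k}.ncard : ℂ) * c ^ k *
              (∑ᶠ D' ∈ {D : V →₀ ℕ | HKdeg f D = k}, HKFc f c D') := by
  classical
  intro n
  have hS := finite_HKdeg_eq f hf hfin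
  have hpairs : ∑ D ∈ (hS n).toFinset, ∑ B ∈ Finset.Iic D, c ^ HKdeg f B * HKFc f c B
      = ∑ k ∈ Finset.range (n + 1), ∑ p ∈ (hS (n - k)).toFinset ×ˢ (hS k).toFinset,
          c ^ HKdeg f p.2 * HKFc f c p.2 := by
    rw [Finset.sum_sigma', Finset.sum_sigma']
    refine Finset.sum_bij' (fun x _ => ⟨HKdeg f x.2, x.1 - x.2, x.2⟩)
      (fun y _ => ⟨y.2.1 + y.2.2, y.2.2⟩) ?_ ?_ ?_ ?_ fun _ _ => rfl
    · rintro ⟨D, B⟩ h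
      simp only [Finset.mem_sigma, Set.Finite.mem_toFinset, Set.mem_ofPred_eq, Finset.mem_Iic] at h
      have hdeg := HKdeg_add f (D - B) B
      rw [tsub_add_cancel_of_le h.2] at hdeg
      simp only [Finset.mem_sigma, Finset.mem_product, Set.Finite.mem_toFinset, Set.mem_ofPred_eq,
        Finset.mem_range, and_true]
      omega
    · rintro ⟨k, A, B⟩ h
      simp only [Finset.mem_sigma, Finset.mem_product, Set.Finite.mem_toFinset, Set.mem_ofPred_eq,
        Finset.mem_range] at h
      simp only [Finset.mem_sigma, Set.Finite.mem_toFinset, Set.mem_ofPred_eq, Finset.mem_Iic,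
        HKdeg_add]
      exact ⟨by omega, le_add_self⟩
    · rintro ⟨D, B⟩ h
      simp only [Finset.mem_sigma, Finset.mem_Iic] at h
      simp [tsub_add_cancel_of_le h.2]
    · rintro ⟨k, A, B⟩ h
      simp only [Finset.mem_sigma, Finset.mem_product, Set.Finite.mem_toFinset,
        Set.mem_ofPred_eq] at h
      simp [h.2.2]
  calc c ^ n * ({D : V →₀ ℕ | HKdeg f D = n}.ncard : ℂ)
      = ∑ D ∈ (hS n).toFinset, c ^ HKdeg f D := by
        rw [Set.ncard_eq_toFinset_card _ (hS n), mul_comm, ← nsmul_eq_mul]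
        refine (Finset.sum_eq_card_nsmul fun D hD => ?_).symm
        rw [(hS n).mem_toFinset.mp hD]
    _ = _ := by
        rw [← Finset.sum_congr rfl fun D _ => sum_Iic_pow_HKdeg_mul_HKFc f hc D, hpairs]
        refine Finset.sum_congr rfl fun k _ => ?_
        rw [Finset.sum_product]
        dsimp only
        rw [Finset.sum_const, nsmul_eq_mul,
          Set.ncard_eq_toFinset_card _ (hS (n - k)),
          finsum_mem_eq_finite_toFinset_sum _ (hS k), mul_assoc]
        congr 1
        rw [Finset.mul_sum]
        refine Finset.sum_congr rfl fun B hB => ?_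
        rw [(hS k).mem_toFinset.mp hB]
end

section
/- Assume r ≥ 2 and a_r > 0. Then the set of K-points X_d(a₁,…,a_r)(K) is the disjoint union of the following three pieces: (i) the image of X_{d−1}(a₁,…,a_{r−1})(K) under the embedding ι; (ii) the set-difference ℙ^r₁ ∖ ℙ^{r−1}₁ of the images of ℙ^r(K) and ℙ^{r−1}(K) under the embeddings j_{r} and j_{r−1}; and (iii) for each t′ with 2 ≤ t′ ≤ t, the image of the set of K-points of the good open subset U_{t′+r−1}(a₁,…,a_r) under the embedding ι_{t′}; moreover all these pieces are pairwise disjoint. -/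
/-- The defining equations of the Hirzebruch–Kleinschmidt variety `X_{t+r-1}(a₁,…,a_r)`,
on homogeneous coordinate vectors: coordinates on `ℙ^{rt}` are indexed by
`Option (Fin t × Fin r)` (`none` is `x₀`, `some (i,j)` is `x_{(i+1)(j+1)}`) and
coordinates on `ℙ^{t-1}` by `Fin t`. The equations read
`x_{mj} y_n^{a_j} = x_{nj} y_m^{a_j}` for all `j` and all `m ≠ n`. -/
def HKrel (K : Type*) [Field K] {r t : ℕ} (a : Fin r → ℕ)
    (x : Option (Fin t × Fin r) → K) (y : Fin t → K) : Prop :=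
  ∀ (j : Fin r) (m n : Fin t), m ≠ n →
    x (some (m, j)) * y n ^ a j = x (some (n, j)) * y m ^ a j

/-- Two coordinate vectors define the same point of projective space: they differ by a
nonzero scalar. -/
def ScaleEq (K : Type*) [Field K] {α : Type*} (x x' : α → K) : Prop :=
  ∃ c : K, c ≠ 0 ∧ x = c • x'

/-- The `x`-part of the embedding `ι_{t₁,r₁} : X_{t₁+r₁-1}(a₁,…,a_{r₁}) → X_{t+r-1}(a₁,…,a_r)`:
`x̃_{ij} = x_{1j}` if `j ≤ r₁` and `a_j = 0`; `x̃_{ij} = x_{ij}` if `j ≤ r₁`, `a_j > 0` and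
`i ≤ t₁`; and `x̃_{ij} = 0` otherwise. -/
def iotaX (K : Type*) [Field K] (t r t₁ r₁ : ℕ) (a : Fin r → ℕ)
    (x : Option (Fin t₁ × Fin r₁) → K) : Option (Fin t × Fin r) → K := fun o =>
  match o with
  | none => x none
  | some (i, j) =>
      if hj : (j : ℕ) < r₁ then
        if h0 : 0 < t₁ then
          if a j = 0 then x (some (⟨0, h0⟩, ⟨(j : ℕ), hj⟩))
          else if hi : (i : ℕ) < t₁ then x (some (⟨(i : ℕ), hi⟩, ⟨(j : ℕ), hj⟩)) else 0
        else 0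
      else 0

/-- The `y`-part of the embedding `ι_{t₁,r₁}`: `[y₁ : … : y_{t₁}] ↦ [y₁ : … : y_{t₁} : 0 : … : 0]`. -/
def iotaY (K : Type*) [Field K] (t t₁ : ℕ) (y : Fin t₁ → K) : Fin t → K := fun i =>
  if hi : (i : ℕ) < t₁ then y ⟨(i : ℕ), hi⟩ else 0

/-- The `x`-part of the embedding `j_{r₁} : ℙ^{r₁}(K) → X_{t+r-1}(a₁,…,a_r)(K)`:
`z̃₀ = z₀`, and `z̃_{ij} = z_j` if `j ≤ r₁` and either `a_j = 0` (any `i`) or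
(`a_j > 0` and `i = 1`), and `z̃_{ij} = 0` otherwise. -/
def jmapX (K : Type*) [Field K] (t r r₁ : ℕ) (a : Fin r → ℕ) (z : Fin (r₁ + 1) → K) :
    Option (Fin t × Fin r) → K := fun o =>
  match o with
  | none => z 0
  | some (i, j) =>
      if hj : (j : ℕ) + 1 < r₁ + 1 then
        if a j = 0 then z ⟨(j : ℕ) + 1, hj⟩
        else if (i : ℕ) = 0 then z ⟨(j : ℕ) + 1, hj⟩ else 0
      else 0

/-- The `y`-part of the embedding `j_{r₁}`: the point `[1 : 0 : … : 0]` of `ℙ^{t-1}`. -/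
def jmapY (K : Type*) [Field K] (t : ℕ) : Fin t → K := fun i =>
  if (i : ℕ) = 0 then 1 else 0

/-- Restriction of a coordinate vector to the coordinates with indices `i ≤ t₁` and `j ≤ r₁`. -/
def restrictX {K : Type*} {r t r₁ t₁ : ℕ} (hr : r₁ ≤ r) (ht : t₁ ≤ t)
    (x : Option (Fin t × Fin r) → K) : Option (Fin t₁ × Fin r₁) → K :=
  fun o => x (o.map (Prod.map (Fin.castLE ht) (Fin.castLE hr)))

section HirzebruchKleinschmidt

variable {K : Type*} [Field K] {r t r₁ t₁ : ℕ} {a : Fin r → ℕ}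
  {x : Option (Fin t × Fin r) → K} {y : Fin t → K}

theorem HKrel.eq (h : HKrel K a x y) (j : Fin r) (m n : Fin t) :
    x (some (m, j)) * y n ^ a j = x (some (n, j)) * y m ^ a j := by
  rcases eq_or_ne m n with rfl | hmn
  · rfl
  · exact h j m n hmn

theorem HKrel.eq_of_exponent_eq_zero (h : HKrel K a x y) {j : Fin r} (hj : a j = 0)
    (m n : Fin t) : x (some (m, j)) = x (some (n, j)) := by
  simpa [hj] using h.eq j m n

theorem HKrel.smul (h : HKrel K a x y) (c d : K) : HKrel K a (c • x) (d • y) := by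
  intro j m n _
  simp only [Pi.smul_apply, smul_eq_mul, mul_pow]
  linear_combination c * d ^ a j * h.eq j m n

theorem HKrel.ne_zero_of_ne_zero (h : HKrel K a x y) {j : Fin r} {m n : Fin t}
    (hx : x (some (m, j)) ≠ 0) (hy : y n ≠ 0) : x (some (n, j)) ≠ 0 := by
  intro h0
  have := h.eq j m n
  rw [h0, zero_mul] at this
  exact mul_ne_zero hx (pow_ne_zero _ hy) this

theorem HKrel.base_ne_zero (h : HKrel K a x y) (hy : y ≠ 0) {j : Fin r} (hj : 0 < a j)
    {m : Fin t} (hx : x (some (m, j)) ≠ 0) : y m ≠ 0 := by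
  intro h0
  refine hy (funext fun n => ?_)
  have := h.eq j m n
  rw [h0, zero_pow hj.ne', mul_zero] at this
  exact eq_zero_of_pow_eq_zero ((mul_eq_zero.mp this).resolve_left hx)

theorem HKrel.restrict (h : HKrel K a x y) (hr : r₁ ≤ r) (ht : t₁ ≤ t) :
    HKrel K (fun j => a (Fin.castLE hr j)) (restrictX hr ht x) (fun i => y (Fin.castLE ht i)) :=
  fun _ _ _ _ => h.eq _ _ _

theorem iotaX_some_of_le (i : Fin t) {j : Fin r} (hj : r₁ ≤ (j : ℕ))
    (x : Option (Fin t₁ × Fin r₁) → K) : iotaX K t r t₁ r₁ a x (some (i, j)) = 0 := by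
  simp [iotaX, hj.not_gt]

theorem iotaY_castLE (ht : t₁ ≤ t) (y : Fin t₁ → K) (i : Fin t₁) :
    iotaY K t t₁ y (Fin.castLE ht i) = y i := by
  simp [iotaY]

theorem iotaY_of_le (y : Fin t₁ → K) {i : Fin t} (hi : t₁ ≤ (i : ℕ)) :
    iotaY K t t₁ y i = 0 := by
  simp [iotaY, hi.not_gt]

theorem iotaX_castLE (hr : r₁ ≤ r) (ht : t₁ ≤ t) {x : Option (Fin t₁ × Fin r₁) → K}
    {y : Fin t₁ → K} (h : HKrel K (fun j => a (Fin.castLE hr j)) x y) (i : Fin t₁) (j : Fin r₁) :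
    iotaX K t r t₁ r₁ a x (some (Fin.castLE ht i, Fin.castLE hr j)) = x (some (i, j)) := by
  have h0 : 0 < t₁ := i.pos
  by_cases hj : a (Fin.castLE hr j) = 0
  · simpa [iotaX, h0, hj] using h.eq_of_exponent_eq_zero hj ⟨0, h0⟩ i
  · simp [iotaX, h0, hj]

theorem iotaX_ne_zero (hr : r₁ ≤ r) (ht : t₁ ≤ t) {x : Option (Fin t₁ × Fin r₁) → K}
    {y : Fin t₁ → K} (h : HKrel K (fun j => a (Fin.castLE hr j)) x y) (hx : x ≠ 0) :
    iotaX K t r t₁ r₁ a x ≠ 0 := by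
  intro h0
  refine hx (funext fun o => ?_)
  match o with
  | none => exact congrFun h0 none
  | some (i, j) => rw [← iotaX_castLE hr ht h i j, h0]; rfl

theorem iotaY_ne_zero (ht : t₁ ≤ t) {y : Fin t₁ → K} (hy : y ≠ 0) : iotaY K t t₁ y ≠ 0 := by
  intro h0
  refine hy (funext fun i => ?_)
  rw [← iotaY_castLE ht y i, h0]; rfl

theorem HKrel.iota (hr : r₁ ≤ r) {x : Option (Fin t₁ × Fin r₁) → K}
    {y : Fin t₁ → K} (h : HKrel K (fun j => a (Fin.castLE hr j)) x y) :
    HKrel K a (iotaX K t r t₁ r₁ a x) (iotaY K t t₁ y) := by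
  intro j m n _
  by_cases hj : (j : ℕ) < r₁
  · by_cases h0 : 0 < t₁
    · by_cases haj : a j = 0
      · simp [iotaX, hj, h0, haj]
      · have key := h.eq ⟨j, hj⟩
        by_cases hm : (m : ℕ) < t₁ <;> by_cases hn : (n : ℕ) < t₁ <;>
          simp [iotaX, iotaY, hj, h0, haj, hm, hn]
        exact key ⟨m, hm⟩ ⟨n, hn⟩
    · simp [iotaX, h0]
  · simp [iotaX, hj]

theorem iotaX_restrictX (h : HKrel K a x y) (hr : r₁ ≤ r) (ht : t₁ ≤ t) (hy : y ≠ 0)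
    (hxr : ∀ (i : Fin t) (j : Fin r), r₁ ≤ (j : ℕ) → x (some (i, j)) = 0) (hyt : ∀ i : Fin t, t₁ ≤ (i : ℕ) → y i = 0) :
    iotaX K t r t₁ r₁ a (restrictX hr ht x) = x := by
  obtain ⟨n, hn⟩ := Function.ne_iff.mp hy
  have hnt : (n : ℕ) < t₁ := not_le.mp fun hle => hn (hyt n hle)
  have h0 : 0 < t₁ := by omega
  funext o
  match o with
  | none => rfl
  | some (i, j) =>
    by_cases hj : (j : ℕ) < r₁
    · by_cases haj : a j = 0
      · simpa [iotaX, hj, h0, haj, restrictX] using h.eq_of_exponent_eq_zero haj _ i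
      · by_cases hi : (i : ℕ) < t₁
        · simp [iotaX, hj, h0, haj, hi, restrictX]
        · have hxi : x (some (i, j)) = 0 := by
            by_contra hne
            exact h.base_ne_zero hy (Nat.pos_of_ne_zero haj) hne (hyt i (not_lt.mp hi))
          simp [iotaX, hj, h0, haj, hi, hxi]
    · simp [iotaX, hj, hxr i j (not_lt.mp hj)]

theorem iotaY_restrict (ht : t₁ ≤ t) (hyt : ∀ i : Fin t, t₁ ≤ (i : ℕ) → y i = 0) :
    iotaY K t t₁ (fun i => y (Fin.castLE ht i)) = y := by
  funext i
  by_cases hi : (i : ℕ) < t₁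
  · simp [iotaY, hi]
  · simp [iotaY, hi, hyt i (not_lt.mp hi)]

theorem ScaleEq.refl {α : Type*} (x : α → K) : ScaleEq K x x := ⟨1, one_ne_zero, by simp⟩

/-- A point scaled from the image of the embedding `ι_{t₁,r₁}` lies on the variety, and its
coordinates outside the range of the indices of the source vanish. -/
theorem HKrel.of_scaleEq_iota (hr : r₁ ≤ r) (ht : t₁ ≤ t) {x₁ : Option (Fin t₁ × Fin r₁) → K}
    {y₁ : Fin t₁ → K} (hx₁ : x₁ ≠ 0) (hy₁ : y₁ ≠ 0)
    (h : HKrel K (fun j => a (Fin.castLE hr j)) x₁ y₁)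
    (hx : ScaleEq K x (iotaX K t r t₁ r₁ a x₁)) (hy : ScaleEq K y (iotaY K t t₁ y₁)) :
    (x ≠ 0 ∧ y ≠ 0 ∧ HKrel K a x y) ∧ (∀ (i : Fin t) (j : Fin r), r₁ ≤ (j : ℕ) → x (some (i, j)) = 0) ∧
      ∀ i : Fin t, t₁ ≤ (i : ℕ) → y i = 0 := by
  obtain ⟨c, hc, rfl⟩ := hx
  obtain ⟨d, hd, rfl⟩ := hy
  refine ⟨⟨smul_ne_zero hc (iotaX_ne_zero hr ht h hx₁), smul_ne_zero hd (iotaY_ne_zero ht hy₁),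
    (h.iota hr).smul c d⟩, fun i j hj => ?_, fun i hi => ?_⟩
  · simp [iotaX_some_of_le i hj]
  · simp [iotaY_of_le y₁ hi]

/-- A point of the variety whose coordinates outside the index ranges of `ι_{t₁,r₁}` vanish is
the image of its restriction. -/
theorem HKrel.restrict_spec (h : HKrel K a x y) (hx : x ≠ 0) (hy : y ≠ 0) (hr : r₁ ≤ r)
    (ht : t₁ ≤ t) (hxr : ∀ (i : Fin t) (j : Fin r), r₁ ≤ (j : ℕ) → x (some (i, j)) = 0)
    (hyt : ∀ i : Fin t, t₁ ≤ (i : ℕ) → y i = 0) :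
    restrictX hr ht x ≠ 0 ∧ (fun i => y (Fin.castLE ht i)) ≠ 0 ∧
      HKrel K (fun j => a (Fin.castLE hr j)) (restrictX hr ht x) (fun i => y (Fin.castLE ht i)) ∧
      ScaleEq K x (iotaX K t r t₁ r₁ a (restrictX hr ht x)) ∧
      ScaleEq K y (iotaY K t t₁ (fun i => y (Fin.castLE ht i))) := by
  have hX := iotaX_restrictX h hr ht hy hxr hyt
  have hY := iotaY_restrict ht hyt
  refine ⟨fun h0 => hx ?_, fun h0 => hy ?_, h.restrict hr ht, ?_, ?_⟩
  · rw [← hX, h0]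
    funext o
    match o with
    | none => rfl
    | some (i, j) => simp [iotaX]
  · rw [← hY, h0]
    funext i
    simp [iotaY]
  · rw [hX]; exact .refl x
  · rw [hY]; exact .refl y

theorem exists_scaleEq_iota_iff (hr : r₁ ≤ r) (ht : t₁ ≤ t) :
    (∃ (x₁ : Option (Fin t₁ × Fin r₁) → K) (y₁ : Fin t₁ → K), x₁ ≠ 0 ∧ y₁ ≠ 0 ∧
        HKrel K (fun j => a (Fin.castLE hr j)) x₁ y₁ ∧
        ScaleEq K x (iotaX K t r t₁ r₁ a x₁) ∧ ScaleEq K y (iotaY K t t₁ y₁)) ↔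
      (x ≠ 0 ∧ y ≠ 0 ∧ HKrel K a x y) ∧ (∀ (i : Fin t) (j : Fin r), r₁ ≤ (j : ℕ) → x (some (i, j)) = 0) ∧
        ∀ i : Fin t, t₁ ≤ (i : ℕ) → y i = 0 := by
  constructor
  · rintro ⟨x₁, y₁, hx₁, hy₁, h, hx, hy⟩
    exact h.of_scaleEq_iota hr ht hx₁ hy₁ hx hy
  · rintro ⟨⟨hx, hy, h⟩, hxr, hyt⟩
    exact ⟨_, _, h.restrict_spec hx hy hr ht hxr hyt⟩

/-- The embedding `j_{r₁}` is `ι_{1,r₁}` after identifying `ℙ^{r₁}` with `X_{r₁}(a₁,…,a_{r₁})`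
for `t = 1`. -/
theorem jmapX_eq_iotaX (x : Option (Fin 1 × Fin r₁) → K) :
    jmapX K t r r₁ a (Fin.cons (x none) fun j => x (some (0, j))) = iotaX K t r 1 r₁ a x := by
  funext o
  match o with
  | none => rfl
  | some (i, j) =>
    by_cases hj : (j : ℕ) < r₁
    · have hc : (Fin.cons (x none) fun j => x (some (0, j)) : Fin (r₁ + 1) → K)
          ⟨(j : ℕ) + 1, Nat.succ_lt_succ hj⟩ = x (some (0, ⟨j, hj⟩)) := rfl
      by_cases haj : a j = 0
      · simp [jmapX, iotaX, hj, haj, hc]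
      · by_cases hi : (i : ℕ) = 0 <;> simp [jmapX, iotaX, hj, haj, hc, hi]
    · simp [jmapX, iotaX, hj]

theorem iotaY_one (y : Fin 1 → K) : iotaY K t 1 y = y 0 • jmapY K t := by
  funext i
  by_cases hi : (i : ℕ) = 0 <;> simp [iotaY, jmapY, hi]

theorem exists_scaleEq_jmap_iff (hr : r₁ ≤ r) (ht : 1 ≤ t) :
    (∃ z : Fin (r₁ + 1) → K, z ≠ 0 ∧
        ScaleEq K x (jmapX K t r r₁ a z) ∧ ScaleEq K y (jmapY K t)) ↔
      (x ≠ 0 ∧ y ≠ 0 ∧ HKrel K a x y) ∧ (∀ (i : Fin t) (j : Fin r), r₁ ≤ (j : ℕ) → x (some (i, j)) = 0) ∧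
        ∀ i : Fin t, 1 ≤ (i : ℕ) → y i = 0 := by
  rw [← exists_scaleEq_iota_iff hr ht]
  constructor
  · rintro ⟨z, hz, hx, hy⟩
    have hz' : (Fin.cons (z 0) fun j : Fin r₁ => z j.succ) = z := Fin.cons_self_tail z
    refine ⟨fun o => o.elim (z 0) fun q => z q.2.succ, 1, fun h0 => hz ?_, one_ne_zero,
      fun _ m n hmn => absurd (Subsingleton.elim m n) hmn, ?_, ?_⟩
    · rw [← hz']
      funext i
      refine Fin.cases ?_ (fun j => ?_) i
      · exact congrFun h0 none
      · exact congrFun h0 (some (0, j))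
    · rw [← jmapX_eq_iotaX]
      simpa only [Option.elim_none, Option.elim_some, hz'] using hx
    · simpa [iotaY_one] using hy
  · rintro ⟨x₁, y₁, hx₁, hy₁, -, hx, d, hd, hy⟩
    have hy0 : y₁ 0 ≠ 0 := fun h0 => hy₁ (funext fun i => by rw [Subsingleton.elim i 0, h0]; rfl)
    refine ⟨Fin.cons (x₁ none) fun j => x₁ (some (0, j)), fun h0 => hx₁ (funext fun o => ?_),
      by rwa [jmapX_eq_iotaX], d * y₁ 0, mul_ne_zero hd hy0, by rw [hy, iotaY_one, smul_smul]⟩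
    match o with
    | none => exact congrFun h0 0
    | some (i, j) => rw [Subsingleton.elim i 0]; exact congrFun h0 j.succ

theorem exists_scaleEq_iota_good_iff {s : ℕ} (hs : s + 2 ≤ t) {l : Fin r} (hl : 0 < a l) :
    (∃ (x₁ : Option (Fin (s + 2) × Fin r) → K) (y₁ : Fin (s + 2) → K), x₁ ≠ 0 ∧ y₁ ≠ 0 ∧
        HKrel K a x₁ y₁ ∧ x₁ (some (Fin.last (s + 1), l)) ≠ 0 ∧
        ScaleEq K x (iotaX K t r (s + 2) r a x₁) ∧ ScaleEq K y (iotaY K t (s + 2) y₁)) ↔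
      (x ≠ 0 ∧ y ≠ 0 ∧ HKrel K a x y) ∧ (∃ i, x (some (i, l)) ≠ 0) ∧
        y ⟨s + 1, hs⟩ ≠ 0 ∧ ∀ i : Fin t, s + 2 ≤ (i : ℕ) → y i = 0 := by
  constructor
  · rintro ⟨x₁, y₁, hx₁, hy₁, h, hne, hx, hy⟩
    obtain ⟨⟨hx0, hy0, hxy⟩, -, hyt⟩ := h.of_scaleEq_iota le_rfl hs hx₁ hy₁ hx hy
    have hxl : x (some (⟨s + 1, hs⟩, l)) ≠ 0 := by
      obtain ⟨c, hc, rfl⟩ := hx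
      exact mul_ne_zero hc
        ((iotaX_castLE le_rfl hs h (Fin.last (s + 1)) l).trans_ne hne)
    exact ⟨⟨hx0, hy0, hxy⟩, ⟨_, hxl⟩, hxy.base_ne_zero hy0 hl hxl, hyt⟩
  · rintro ⟨⟨hx, hy, h⟩, ⟨i, hi⟩, hys, hyt⟩
    obtain ⟨h₁, h₂, h₃, h₄, h₅⟩ := h.restrict_spec hx hy le_rfl hs
      (fun _ j hj => absurd j.isLt hj.not_gt) hyt
    exact ⟨_, _, h₁, h₂, h₃, h.ne_zero_of_ne_zero hi hys, h₄, h₅⟩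

end HirzebruchKleinschmidt

theorem exists_last_ne_zero {M : Type*} [Zero M] {t : ℕ} {y : Fin t → M} (hy : y ≠ 0) :
    ∃ m, y m ≠ 0 ∧ ∀ i, m < i → y i = 0 := by
  obtain ⟨n, hn⟩ := Function.ne_iff.mp hy
  obtain ⟨m, hm⟩ := (Set.toFinite {i | y i ≠ 0}).exists_maximal ⟨n, hn⟩
  exact ⟨m, hm.prop, fun i hi => not_not.mp fun hne => hm.not_gt hne hi⟩

/-- Decomposition of a Hirzebruch–Kleinschmidt variety, case `r ≥ 2`, `a_r > 0`:
`X_d(a₁,…,a_r)(K)` is the disjoint union of (i) the image of `X_{d-1}(a₁,…,a_{r-1})(K)`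
under `ι = ι_{t,r-1}`, (ii) `ℙ^r₁ ∖ ℙ^{r-1}₁`, and (iii) the images of the good open
subsets `U_{t'+r-1}(a₁,…,a_r)(K)` under `ι_{t'}` for `2 ≤ t' ≤ t`.  `K`-points of
projective space are modeled by their nonzero homogeneous coordinate vectors, up to the
(scaling-invariant) equivalence `ScaleEq`; all the sets below are saturated under
scaling, so this faithfully encodes the statement at the level of `K`-points. -/
theorem stmt_10 (K : Type*) [Field K] (r t : ℕ) (hr : 2 ≤ r) (ht : 2 ≤ t)
    (a : Fin r → ℕ) (hmono : Monotone a) (har : 0 < a ⟨r - 1, by omega⟩) :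
    -- the set of `K`-points of `X_d(a₁,…,a_r)`, as pairs of coordinate vectors
    let bigX : Set ((Option (Fin t × Fin r) → K) × (Fin t → K)) :=
      {p | p.1 ≠ 0 ∧ p.2 ≠ 0 ∧ HKrel K a p.1 p.2}
    -- (i) the image of `X_{d-1}(a₁,…,a_{r-1})(K)` under `ι`
    let A : Set ((Option (Fin t × Fin r) → K) × (Fin t → K)) :=
      {p | ∃ (x : Option (Fin t × Fin (r - 1)) → K) (y : Fin t → K),
        x ≠ 0 ∧ y ≠ 0 ∧ HKrel K (fun j => a (Fin.castLE (by omega) j)) x y ∧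
        ScaleEq K p.1 (iotaX K t r t (r - 1) a x) ∧ ScaleEq K p.2 (iotaY K t t y)}
    -- the image `ℙ^{r₁}₁` of `ℙ^{r₁}(K)` under `j_{r₁}`
    let P : ℕ → Set ((Option (Fin t × Fin r) → K) × (Fin t → K)) := fun r₁ =>
      {p | ∃ z : Fin (r₁ + 1) → K, z ≠ 0 ∧
        ScaleEq K p.1 (jmapX K t r r₁ a z) ∧ ScaleEq K p.2 (jmapY K t)}
    -- (iii) the image of `U_{t'+r-1}(a₁,…,a_r)(K)` under `ι_{t'}`, for `t' = t'' + 2`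
    let C : ℕ → Set ((Option (Fin t × Fin r) → K) × (Fin t → K)) := fun t'' =>
      {p | ∃ (x : Option (Fin (t'' + 2) × Fin r) → K) (y : Fin (t'' + 2) → K),
        x ≠ 0 ∧ y ≠ 0 ∧ HKrel K a x y ∧
        x (some (Fin.last (t'' + 1), ⟨r - 1, by omega⟩)) ≠ 0 ∧
        ScaleEq K p.1 (iotaX K t r (t'' + 2) r a x) ∧ ScaleEq K p.2 (iotaY K t (t'' + 2) y)}
    -- the decomposition
    bigX = A ∪ (P r \ P (r - 1)) ∪ (⋃ (t'' : ℕ) (_ : t'' + 2 ≤ t), C t'') ∧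
    -- pairwise disjointness of the pieces
    Disjoint A (P r \ P (r - 1)) ∧
    (∀ t'' : ℕ, t'' + 2 ≤ t → Disjoint A (C t'') ∧ Disjoint (P r \ P (r - 1)) (C t'')) ∧
    (∀ t₁ t₂ : ℕ, t₁ + 2 ≤ t → t₂ + 2 ≤ t → t₁ ≠ t₂ → Disjoint (C t₁) (C t₂)) := by
  intro bigX A P C
  have mem_A : ∀ p, p ∈ A ↔ p ∈ bigX ∧ ∀ i, p.1 (some (i, ⟨r - 1, by omega⟩)) = 0 := by
    intro p
    refine (exists_scaleEq_iota_iff (Nat.sub_le r 1) le_rfl).trans (and_congr_right fun _ => ?_)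
    refine ⟨fun h i => h.1 i _ le_rfl, fun h => ⟨fun i j hj => ?_, fun i hi => by omega⟩⟩
    rw [show j = ⟨r - 1, by omega⟩ from Fin.ext (by simp; omega)]
    exact h i
  have mem_P : ∀ p, p ∈ P r \ P (r - 1) ↔ p ∈ bigX ∧
      (∃ i, p.1 (some (i, ⟨r - 1, by omega⟩)) ≠ 0) ∧ ∀ i : Fin t, 1 ≤ (i : ℕ) → p.2 i = 0 := by
    intro p
    refine (and_congr (exists_scaleEq_jmap_iff le_rfl (by omega))
      (not_congr (exists_scaleEq_jmap_iff (Nat.sub_le r 1) (by omega)))).trans ?_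
    constructor
    · rintro ⟨⟨hp, -, hy⟩, hn⟩
      refine ⟨hp, ?_, hy⟩
      by_contra! h
      refine hn ⟨hp, fun i j hj => ?_, hy⟩
      rw [show j = ⟨r - 1, by omega⟩ from Fin.ext (by simp; omega)]
      exact h i
    · rintro ⟨hp, ⟨i, hi⟩, hy⟩
      exact ⟨⟨hp, fun _ j hj => absurd j.isLt hj.not_gt, hy⟩, fun h => hi (h.2.1 i _ le_rfl)⟩
  have mem_C : ∀ s (hs : s + 2 ≤ t) p, p ∈ C s ↔ p ∈ bigX ∧
      (∃ i, p.1 (some (i, ⟨r - 1, by omega⟩)) ≠ 0) ∧ p.2 ⟨s + 1, hs⟩ ≠ 0 ∧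
        ∀ i : Fin t, s + 2 ≤ (i : ℕ) → p.2 i = 0 :=
    fun s hs p => exists_scaleEq_iota_good_iff hs har
  simp only [Set.disjoint_left]
  refine ⟨Set.ext fun p => ?_, fun p hA hP => ?_, fun s hs => ⟨fun p hA hC => ?_,
    fun p hP hC => ?_⟩, fun s₁ s₂ hs₁ hs₂ hne p h₁ h₂ => ?_⟩
  · simp only [Set.mem_union, Set.mem_iUnion, exists_prop]
    constructor
    · intro hp
      by_cases h : ∀ i, p.1 (some (i, ⟨r - 1, by omega⟩)) = 0
      · exact .inl (.inl ((mem_A p).2 ⟨hp, h⟩))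
      push Not at h
      obtain ⟨⟨m, hmt⟩, hm, hlast⟩ := exists_last_ne_zero hp.2.1
      match m with
      | 0 => exact .inl (.inr ((mem_P p).2 ⟨hp, h, fun i hi => hlast i hi⟩))
      | s + 1 => exact .inr ⟨s, hmt, (mem_C s hmt p).2 ⟨hp, h, hm, fun i hi => hlast i hi⟩⟩
    · rintro ((h | h) | ⟨s, hs, h⟩)
      · exact ((mem_A p).1 h).1
      · exact ((mem_P p).1 h).1
      · exact ((mem_C s hs p).1 h).1
  · obtain ⟨-, ⟨i, hi⟩, -⟩ := (mem_P p).1 hP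
    exact hi (((mem_A p).1 hA).2 i)
  · obtain ⟨-, ⟨i, hi⟩, -⟩ := (mem_C s hs p).1 hC
    exact hi (((mem_A p).1 hA).2 i)
  · exact ((mem_C s hs p).1 hC).2.2.1 (((mem_P p).1 hP).2.2 _ (Nat.le_add_left 1 s))
  · obtain ⟨-, -, hy₁, hz₁⟩ := (mem_C s₁ hs₁ p).1 h₁
    obtain ⟨-, -, hy₂, hz₂⟩ := (mem_C s₂ hs₂ p).1 h₂
    rcases hne.lt_or_gt with hlt | hlt
    · exact hy₂ (hz₁ _ (Nat.succ_le_succ hlt))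
    · exact hy₁ (hz₂ _ (Nat.succ_le_succ hlt))
end
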